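/- arXiv:2409.04305 — 2 statements merged into one kernel-verified Lean document; each statement's English description precedes it below -/
import Mathlib

section
/- Let σ ∈ (0,∞) and q ∈ [1,∞). The measure λ^{(q)}_{σ²} on ℝ with density dλ^{(q)}_{σ²}(x)/dx = √(4qσ⁴ − (qx² − (q+1)σ²)²) / (2πσ²|x|) · 1_{B(q,σ)}(x), where B(q,σ) := [−(1+q^{−1/2})σ, −(1−q^{−1/2})σ] ∪ [(1−q^{−1/2})σ, (1+q^{−1/2})σ], is a compactly supported symmetric probability measure on ℝ, and its q-rectangular free cumulants are κ^q_{2ℓ}[λ^{(q)}_{σ²}] = σ² if ℓ = 1 and 0 if ℓ ≥ 2; equivalently, its odd moments vanish and its even moments satisfy ∫ x^{2k} dλ^{(q)}_{σ²}(x) = σ^{2k} · Σ_{π} q^{−even(π)}, the sum being over all noncrossing set partitions π of [2k] all of whose blocks have cardinality 2. -/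
open Finset MeasureTheory

/-- A set partition of `{0,…,n-1}` (representing `[n] = {1,…,n}`) is noncrossing. -/
def IsNoncrossing {n : ℕ} (π : Finpartition (Finset.univ : Finset (Fin n))) : Prop :=
  ∀ a b c d : Fin n, a < b → b < c → c < d →
    ∀ B₁ ∈ π.parts, ∀ B₂ ∈ π.parts,
      a ∈ B₁ → c ∈ B₁ → b ∈ B₂ → d ∈ B₂ → B₁ = B₂

/-- All blocks have even cardinality. -/
def IsEvenPartition {n : ℕ} (π : Finpartition (Finset.univ : Finset (Fin n))) : Prop :=
  ∀ B ∈ π.parts, Even B.card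

open Classical in
/-- The finite set `NC^even(n)` of noncrossing even set partitions of `[n]`. -/
noncomputable def ncEvenPartitions (n : ℕ) :
    Finset (Finpartition (Finset.univ : Finset (Fin n))) :=
  Finset.univ.filter fun π => IsNoncrossing π ∧ IsEvenPartition π

open Classical in
/-- The finite set of noncrossing pair partitions of `[n]` (all blocks of cardinality 2). -/
noncomputable def ncPairPartitions (n : ℕ) :
    Finset (Finpartition (Finset.univ : Finset (Fin n))) :=
  Finset.univ.filter fun π => IsNoncrossing π ∧ ∀ B ∈ π.parts, B.card = 2

open Classical in
/-- `even(π)`: the number of blocks of `π` whose smallest element is an even number of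
`[n] = {1,…,n}` (with 0-based `Fin n`, the element `y` represents the number `y+1`). -/
noncomputable def evenCnt {n : ℕ} (π : Finpartition (Finset.univ : Finset (Fin n))) : ℕ :=
  (π.parts.filter fun B =>
    ∃ y : Fin n, y ∈ B ∧ Even ((y : ℕ) + 1) ∧ ∀ x ∈ B, y ≤ x).card

open Classical in
/-- The density of the rectangular analogue `λ^{(q)}_{σ²}` of the Gaussian distribution. -/
noncomputable def rectGaussDensity (q σ : ℝ) (x : ℝ) : ℝ :=
  if x ∈ Set.Icc (-((1 + (Real.sqrt q)⁻¹) * σ)) (-((1 - (Real.sqrt q)⁻¹) * σ)) ∪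
       Set.Icc ((1 - (Real.sqrt q)⁻¹) * σ) ((1 + (Real.sqrt q)⁻¹) * σ) then
    Real.sqrt (4 * q * σ ^ 4 - (q * x ^ 2 - (q + 1) * σ ^ 2) ^ 2) /
      (2 * Real.pi * σ ^ 2 * |x|)
  else 0

/-- The measure `λ^{(q)}_{σ²}` on `ℝ`. -/
noncomputable def rectGauss (q σ : ℝ) : Measure ℝ :=
  MeasureTheory.volume.withDensity fun x => ENNReal.ofReal (rectGaussDensity q σ x)


open Classical in
/-- Noncrossing perfect matchings of the integer interval `[a,b)`, as sets of pairs. -/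
noncomputable def ncM (a b : ℕ) : Finset (Finset (ℕ × ℕ)) :=
  ((Finset.Ico a b ×ˢ Finset.Ico a b).powerset).filter fun S =>
    (∀ x y, (x, y) ∈ S → x < y) ∧
    (∀ x, a ≤ x → x < b → ∃ y, (x, y) ∈ S ∨ (y, x) ∈ S) ∧
    (∀ x y z, (x, y) ∈ S → (x, z) ∈ S → y = z) ∧
    (∀ x y z, (y, x) ∈ S → (z, x) ∈ S → y = z) ∧
    (∀ x y z, (x, y) ∈ S → (y, z) ∉ S) ∧
    (∀ x y z t, x < y → y < z → z < t → (x, z) ∈ S → (y, t) ∉ S)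

structure NCM (a b : ℕ) (S : Finset (ℕ × ℕ)) : Prop where
  mem : ∀ x y, (x, y) ∈ S → a ≤ x ∧ x < y ∧ y < b
  cov : ∀ x, a ≤ x → x < b → ∃ y, (x, y) ∈ S ∨ (y, x) ∈ S
  fst : ∀ x y z, (x, y) ∈ S → (x, z) ∈ S → y = z
  snd : ∀ x y z, (y, x) ∈ S → (z, x) ∈ S → y = z
  dis : ∀ x y z, (x, y) ∈ S → (y, z) ∉ S
  nc : ∀ x y z t, x < y → y < z → z < t → (x, z) ∈ S → (y, t) ∉ S

lemma mem_ncM (a b : ℕ) (S : Finset (ℕ × ℕ)) : S ∈ ncM a b ↔ NCM a b S := by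
  unfold ncM
  simp only [mem_filter, mem_powerset]
  constructor
  · rintro ⟨h0, h1, h2, h3, h4, h5, h6⟩
    refine ⟨fun x y h => ?_, h2, h3, h4, h5, h6⟩
    have := h0 h
    have := h1 _ _ h
    simp at *
    omega
  · rintro ⟨h1, h2, h3, h4, h5, h6⟩
    refine ⟨?_, fun x y h => (h1 x y h).2.1, h2, h3, h4, h5, h6⟩
    rintro ⟨x, y⟩ h
    have := h1 _ _ h
    simp at *
    omega

lemma NCM.glue {a b c : ℕ} (hac : a < c) (hcb : c < b) {X Y : Finset (ℕ × ℕ)}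
    (hX : NCM (a+1) c X) (hY : NCM (c+1) b Y) : NCM a b (insert (a, c) (X ∪ Y)) := by
  obtain ⟨x1, x2, x3, x4, x5, x6⟩ := hX
  obtain ⟨y1, y2, y3, y4, y5, y6⟩ := hY
  constructor
  · intro x y h
    simp only [mem_insert, mem_union, Prod.mk.injEq] at h
    grind
  · intro x h1 h2
    simp only [mem_insert, mem_union, Prod.mk.injEq]
    rcases lt_trichotomy x c with h | h | h
    · by_cases hx : x = a
      · exact ⟨c, by simp [hx]⟩
      · obtain ⟨y, hy⟩ := x2 x (by omega) h
        exact ⟨y, by tauto⟩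
    · exact ⟨a, by simp [h]⟩
    · obtain ⟨y, hy⟩ := y2 x (by omega) h2
      exact ⟨y, by tauto⟩
  · intro x y z h h'
    simp only [mem_insert, mem_union, Prod.mk.injEq] at h h'
    grind
  · intro x y z h h'
    simp only [mem_insert, mem_union, Prod.mk.injEq] at h h'
    grind
  · intro x y z h h'
    simp only [mem_insert, mem_union, Prod.mk.injEq] at h h'
    grind
  · intro x y z t hxy hyz hzt h h'
    simp only [mem_insert, mem_union, Prod.mk.injEq] at h h'
    grind

lemma NCM.restr {a b : ℕ} {S : Finset (ℕ × ℕ)} (hS : NCM a b S) (u v : ℕ)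
    (hu : a ≤ u) (hv : v ≤ b)
    (h : ∀ x y, (x, y) ∈ S → (u ≤ x ∧ x < v ↔ u ≤ y ∧ y < v)) :
    NCM u v (S.filter fun p => u ≤ p.1 ∧ p.1 < v) := by
  obtain ⟨x1, x2, x3, x4, x5, x6⟩ := hS
  constructor
  · intro x y h
    simp only [mem_filter] at h
    grind
  · intro x h1 h2
    obtain ⟨y, hy⟩ := x2 x (by omega) (by omega)
    refine ⟨y, ?_⟩
    simp only [mem_filter]
    rcases hy with hy | hy
    · exact Or.inl ⟨hy, h1, h2⟩
    · exact Or.inr ⟨hy, (h _ _ hy).2 ⟨h1, h2⟩⟩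
  · intro x y z h h'
    simp only [mem_filter] at h h'
    grind
  · intro x y z h h'
    simp only [mem_filter] at h h'
    grind
  · intro x y z h h'
    simp only [mem_filter] at h h'
    grind
  · intro x y z t hxy hyz hzt h h'
    simp only [mem_filter] at h h'
    grind

/-- weighted count -/
noncomputable def ncF (w : ℕ → ℝ) (a b : ℕ) : ℝ := ∑ S ∈ ncM a b, ∏ p ∈ S, w p.1

lemma ncM_self (a b : ℕ) (h : b ≤ a) : ncM a b = {∅} := by
  ext S
  rw [mem_ncM, mem_singleton]
  constructor
  · intro hS
    rw [Finset.eq_empty_iff_forall_notMem]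
    rintro ⟨x, y⟩ hx
    have := hS.mem _ _ hx
    omega
  · rintro rfl
    constructor <;> simp
    omega

lemma ncF_self (w : ℕ → ℝ) (a b : ℕ) (h : b ≤ a) : ncF w a b = 1 := by
  simp [ncF, ncM_self a b h]

lemma NCM.sep {a b c : ℕ} {S : Finset (ℕ × ℕ)} (hS : NCM a b S) (hc : (a, c) ∈ S) 
    {x y : ℕ} (h : (x, y) ∈ S) : (x = a ∧ y = c) ∨ (a < x ∧ x < c ∧ a < y ∧ y < c) ∨
      (c < x ∧ c < y) := by
  obtain ⟨x1, x2, x3, x4, x5, x6⟩ := hS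
  have h1 := x1 _ _ h
  have h2 := x1 _ _ hc
  have h3 := x3 a c y hc
  have h4 := x4 c a x hc
  have h5 := x5 a c y hc
  have h6 := x6 a x c y
  rcases eq_or_ne x a with rfl | hxa
  · left; exact ⟨rfl, (h3 h).symm⟩
  have hyc : y ≠ c := by rintro rfl; exact hxa (h4 h).symm
  have hxc : x ≠ c := by rintro rfl; exact h5 h
  rcases lt_or_gt_of_ne hxc with h7 | h7
  · right; left
    have : ¬ c < y := fun h8 => h6 (by omega) h7 h8 hc h
    omega
  · omega

lemma ncF_rec (w : ℕ → ℝ) (a b : ℕ) (hab : a < b) :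
    ncF w a b = ∑ c ∈ Finset.Ioo a b, w a * (ncF w (a+1) c * ncF w (c+1) b) := by
  classical
  have key : ∀ c ∈ Finset.Ioo a b, w a * (ncF w (a+1) c * ncF w (c+1) b) =
      ∑ S ∈ (ncM a b).filter (fun S => (a, c) ∈ S), ∏ p ∈ S, w p.1 := by
    intro c hc
    rw [Finset.mem_Ioo] at hc
    unfold ncF
    rw [Finset.sum_mul_sum, ← Finset.sum_product', Finset.mul_sum]
    refine Finset.sum_bij' (fun XY _ => insert (a, c) (XY.1 ∪ XY.2))
      (fun S _ => (S.filter (fun p => a + 1 ≤ p.1 ∧ p.1 < c),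
        S.filter (fun p => c + 1 ≤ p.1 ∧ p.1 < b))) ?_ ?_ ?_ ?_ ?_
    · rintro ⟨X, Y⟩ h
      simp only [mem_product, mem_ncM] at h
      simp only [mem_filter, mem_ncM]
      exact ⟨NCM.glue hc.1 hc.2 h.1 h.2, by simp⟩
    · intro S h
      simp only [mem_filter, mem_ncM] at h
      simp only [mem_product, mem_ncM]
      constructor
      · refine h.1.restr _ _ (by omega) (by omega) ?_
        intro x y hxy
        have := h.1.sep h.2 hxy
        omega
      · refine h.1.restr _ _ (by omega) (by omega) ?_
        intro x y hxy
        have := h.1.sep h.2 hxy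
        have := h.1.mem _ _ hxy
        omega
    · rintro ⟨X, Y⟩ h
      simp only [mem_product, mem_ncM] at h
      have h1 := h.1.mem
      have h2 := h.2.mem
      ext ⟨x, y⟩ <;> simp only [mem_filter, mem_insert, mem_union, Prod.mk.injEq] <;> grind
    · intro S h
      simp only [mem_filter, mem_ncM] at h
      ext ⟨x, y⟩
      simp only [mem_filter, mem_insert, mem_union, Prod.mk.injEq]
      constructor
      · rintro (⟨rfl, rfl⟩ | h' | h')
        · exact h.2
        · exact h'.1
        · exact h'.1
      · intro hxy
        have := h.1.sep h.2 hxy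
        have := h.1.mem _ _ hxy
        simp only [hxy, true_and]
        omega
    · rintro ⟨X, Y⟩ h
      simp only [mem_product, mem_ncM] at h
      have h1 := h.1.mem
      have h2 := h.2.mem
      rw [Finset.prod_insert, Finset.prod_union]
      · rw [Finset.disjoint_left]
        rintro ⟨x, y⟩ hx hy
        have := h1 _ _ hx
        have := h2 _ _ hy
        omega
      · rw [mem_union]
        rintro (hx | hx)
        · have := h1 _ _ hx; omega
        · have := h2 _ _ hx; omega
  rw [Finset.sum_congr rfl key]
  unfold ncF
  simp_rw [Finset.sum_filter]
  rw [Finset.sum_comm]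
  refine Finset.sum_congr rfl fun S hS => ?_
  rw [mem_ncM] at hS
  obtain ⟨c, hc⟩ := hS.cov a le_rfl hab
  have hc : (a, c) ∈ S := by
    rcases hc with hc | hc
    · exact hc
    · have := hS.mem _ _ hc; omega
  rw [Finset.sum_eq_single c]
  · simp [hc]
  · intro d _ hd
    rw [if_neg]
    intro h
    exact hd (hS.fst _ _ _ h hc)
  · intro h
    have := hS.mem _ _ hc
    simp at h
    omega

lemma ncF_odd (w : ℕ → ℝ) : ∀ n a : ℕ, Odd n → ncF w a (a + n) = 0 := by
  intro n
  induction n using Nat.strong_induction_on with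
  | _ n ih =>
  intro a hn
  have : 0 < n := hn.pos
  rw [ncF_rec _ _ _ (by omega)]
  refine Finset.sum_eq_zero fun c hc => ?_
  rw [Finset.mem_Ioo] at hc
  rcases Nat.even_or_odd (c - (a+1)) with h | h
  · have := ih (a + n - (c+1)) (by omega) (c+1) (by grind)
    rw [show c + 1 + (a + n - (c+1)) = a + n by omega] at this
    rw [this]; ring
  · have := ih (c - (a+1)) (by omega) (a+1) h
    rw [show a + 1 + (c - (a+1)) = c by omega] at this
    rw [this]; ring

lemma ncF_shift (w : ℕ → ℝ) (hw : ∀ n, w (n+2) = w n) :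
    ∀ n a : ℕ, ncF w (a+2) (a + 2 + n) = ncF w a (a + n) := by
  intro n
  induction n using Nat.strong_induction_on with
  | _ n ih =>
  intro a
  rcases Nat.eq_zero_or_pos n with rfl | hn
  · rw [ncF_self _ _ _ (by omega), ncF_self _ _ _ (by omega)]
  rw [ncF_rec _ _ _ (by omega), ncF_rec w a _ (by omega)]
  symm
  refine Finset.sum_bij (fun c _ => c + 2) ?_ ?_ ?_ ?_
  · intro c; simp; omega
  · intro c; simp
  · intro c hc
    simp at hc
    exact ⟨c - 2, by simp; omega, by omega⟩
  · intro c hc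
    rw [Finset.mem_Ioo] at hc
    have e1 := ih (c - (a+1)) (by omega) (a+1)
    have e2 := ih (a + n - (c+1)) (by omega) (c+1)
    rw [show a + 1 + 2 + (c - (a+1)) = c + 2 by omega, show a + 1 + (c - (a+1)) = c by omega] at e1
    rw [show c + 1 + 2 + (a + n - (c+1)) = a + 2 + n by omega,
      show c + 1 + (a + n - (c+1)) = a + n by omega] at e2
    rw [hw, show a + 2 + 1 = a + 1 + 2 by omega, show c + 2 + 1 = c + 1 + 2 by omega, e1, e2]

lemma ncF_shift_mul (w : ℕ → ℝ) (hw : ∀ n, w (n+2) = w n) (n a m : ℕ) :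
    ncF w (a+2*m) (a + 2*m + n) = ncF w a (a + n) := by
  induction m with
  | zero => simp
  | succ m ih => rw [← ih, ← ncF_shift w hw n (a+2*m)]; rfl

lemma ncF_conv (w : ℕ → ℝ) (hw : ∀ n, w (n+2) = w n) (a k : ℕ) :
    ncF w a (a + 2 * (k+1)) = w a * ∑ p ∈ Finset.HasAntidiagonal.antidiagonal k,
      ncF w (a+1) (a + 1 + 2 * p.1) * ncF w a (a + 2 * p.2) := by
  rw [ncF_rec _ _ _ (by omega), Finset.mul_sum]
  symm
  refine Finset.sum_of_injOn (fun p => a + 1 + 2 * p.1) ?_ ?_ ?_ ?_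
  · rintro ⟨i, j⟩ hp ⟨i', j'⟩ hp' h
    simp at *
    omega
  · rintro ⟨i, j⟩ hp
    simp at *
    omega
  · intro c hc hc'
    rw [Finset.mem_Ioo] at hc
    have : Odd (c - (a+1)) := by
      by_contra h
      rw [Nat.not_odd_iff_even] at h
      obtain ⟨m, hm⟩ := h
      apply hc'
      simp only [Set.mem_image, mem_coe, HasAntidiagonal.mem_antidiagonal]
      exact ⟨(m, k - m), by simp; omega, by simp; omega⟩
    have h := ncF_odd w _ (a+1) this
    rw [show a + 1 + (c - (a+1)) = c by omega] at h
    rw [h]; ring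
  · rintro ⟨i, j⟩ hp
    simp only [HasAntidiagonal.mem_antidiagonal] at hp
    have h := ncF_shift_mul w hw (2*j) a (i+1)
    rw [← h]
    simp only
    rw [show a + 1 + 2 * i + 1 = a + 2 * (i+1) by omega, show a + 2 * (i+1) + 2 * j = a + 2 * (k+1) by omega]

lemma ps_rec (q : ℝ) (hq : q ≠ 0) (a o : ℕ → ℝ) (a0 : a 0 = 1) (o0 : o 0 = 1)
    (ha : ∀ k, a (k+1) = q * ∑ p ∈ Finset.HasAntidiagonal.antidiagonal k, o p.1 * a p.2)
    (ho : ∀ k, o (k+1) = ∑ p ∈ Finset.HasAntidiagonal.antidiagonal k, a p.1 * o p.2) :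
    a 1 = q ∧ a 2 = (q+1) * q ∧ ∀ j : ℕ, ((j:ℝ)+4) * a (j+3) =
      (2*j+5)*(q+1)*a (j+2) - (j+1)*((q+1)^2-4*q)*a (j+1) := by
  have a1 : a 1 = q := by rw [ha 0]; simp [a0, o0]
  have o1 : o 1 = 1 := by rw [ho 0]; simp [a0, o0]
  have a2 : a 2 = (q+1) * q := by
    rw [ha 1]; simp [Finset.Nat.antidiagonal_succ, a0, o0, a1, o1]; ring
  refine ⟨a1, a2, ?_⟩
  have hao : ∀ k, a (k+1) = q * o (k+1) := by
    intro k
    rw [ha, ho, ← Finset.Nat.sum_antidiagonal_swap]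
    simp [mul_comm]
  let N : PowerSeries ℝ := PowerSeries.mk fun k => a (k+1)
  let P : PowerSeries ℝ := PowerSeries.mk fun k => o (k+1)
  have hA : PowerSeries.mk a = 1 + PowerSeries.X * N := by
    ext n; cases n <;> simp [PowerSeries.coeff_succ_X_mul, N, a0, PowerSeries.coeff_one]
  have hO : PowerSeries.mk o = 1 + PowerSeries.X * P := by
    ext n; cases n <;> simp [PowerSeries.coeff_succ_X_mul, P, o0, PowerSeries.coeff_one]
  have hNP : N = PowerSeries.C q * P := by
    ext n; simp [N, P, hao]
  have hN : N = PowerSeries.C q * (PowerSeries.mk o * PowerSeries.mk a) := by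
    ext n; rw [PowerSeries.coeff_C_mul]; simp [N, ha, PowerSeries.coeff_mul]
  have hN2 : N = PowerSeries.C q + PowerSeries.C (q+1) * PowerSeries.X * N
      + PowerSeries.X^2 * N^2 := by
    have : N = (PowerSeries.C q + PowerSeries.X * (PowerSeries.C q * P)) * (1 + PowerSeries.X * N) := by
      conv_lhs => rw [hN, hA, hO]
      ring
    rw [← hNP] at this
    rw [map_add, map_one]
    linear_combination this
  have hNc : ∀ n, PowerSeries.coeff n N = a (n+1) := fun n => by simp [N]
  clear_value N P
  set d := PowerSeries.derivative ℝ N with hd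
  have h2 : d = PowerSeries.C (q+1) * N + PowerSeries.C (q+1) * PowerSeries.X * d
      + 2 * PowerSeries.X * N ^ 2 + 2 * PowerSeries.X ^ 2 * N * d := by
    have := congrArg (PowerSeries.derivative ℝ) hN2
    simp only [map_add, Derivation.leibniz, PowerSeries.derivative_C, PowerSeries.derivative_X,
      Derivation.leibniz_pow, smul_eq_mul, ← hd, nsmul_eq_mul] at this
    rw [map_add]
    push_cast at this
    simp only [pow_one] at this
    linear_combination this
  obtain ⟨b, hb⟩ : ∃ b, b = q + 1 := ⟨_, rfl⟩
  rw [← hb] at hN2 h2 ⊢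
  have hR : (1 - PowerSeries.C b * PowerSeries.X - 2 * PowerSeries.X ^ 2 * N : PowerSeries ℝ) ≠ 0 := by
    intro h
    have := congrArg (PowerSeries.constantCoeff) h
    simp at this
  have h3 : (PowerSeries.X * d) - PowerSeries.C (2 * b) * (PowerSeries.X * (PowerSeries.X * d))
      + PowerSeries.C (b^2-4*q) * (PowerSeries.X * (PowerSeries.X * (PowerSeries.X * d)))
      = PowerSeries.C (2*q) - PowerSeries.C 2 * N + PowerSeries.C (3*b) * (PowerSeries.X * N)
      - PowerSeries.C (b^2-4*q) * (PowerSeries.X * (PowerSeries.X * N)) := by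
    apply mul_left_cancel₀ hR
    simp only [map_sub, map_mul, map_pow, map_ofNat]
    generalize PowerSeries.C b = B at *
    generalize PowerSeries.C q = Q at *
    generalize (PowerSeries.X : PowerSeries ℝ) = X at *
    linear_combination X * (1 - 2 * B * X + (B^2-4*Q)*X^2) * h2 + 2 * (1 - B * X) * hN2
  have hT : ∀ n, PowerSeries.coeff n (PowerSeries.X * d) = n * a (n+1) := by
    intro n
    cases n with
    | zero => simp
    | succ n => rw [PowerSeries.coeff_succ_X_mul, hd, PowerSeries.coeff_derivative, hNc]; push_cast; ring
  intro j
  generalize b^2-4*q = e at h3 ⊢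
  have h4 := congrArg (PowerSeries.coeff (j+2)) h3
  simp only [map_add, map_sub, PowerSeries.coeff_C_mul, hT, hNc, PowerSeries.coeff_succ_X_mul] at h4
  rw [PowerSeries.coeff_C, if_neg (by omega)] at h4
  push_cast at h4
  linear_combination h4

lemma ncF_lin (q : ℝ) (hq : q ≠ 0) (w : ℕ → ℝ) (hw : ∀ n, w (n+2) = w n) (w0 : w 0 = 1)
    (w1 : w 1 = q⁻¹) (n : ℕ → ℝ) (n0 : n 0 = q) (n1 : n 1 = (q+1) * q)
    (hn : ∀ j : ℕ, ((j:ℝ)+4) * n (j+2) =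
      (2*j+5)*(q+1)*n (j+1) - (j+1)*((q+1)^2-4*q)*n j) (k : ℕ) :
    n k = q ^ (k+1) * ncF w 0 (2*(k+1)) := by
  obtain ⟨h1, h2, h3⟩ := ps_rec q hq (fun k => q^k * ncF w 0 (2*k)) (fun k => q^k * ncF w 1 (1+2*k))
    (by simp [ncF_self]) (by simp [ncF_self]) (by
      intro k
      have := ncF_conv w hw 0 k
      simp only [zero_add] at this
      rw [this, w0, one_mul, Finset.mul_sum, Finset.mul_sum]
      refine Finset.sum_congr rfl fun p hp => ?_
      rw [← HasAntidiagonal.mem_antidiagonal.1 hp]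
      ring) (by
      intro k
      have := ncF_conv w hw 1 k
      have sh : ∀ j, ncF w 2 (2 + 2 * j) = ncF w 0 (2 * j) := fun j => by
        have := ncF_shift w hw (2*j) 0
        simpa using this
      rw [this, w1, Finset.mul_sum, Finset.mul_sum]
      refine Finset.sum_congr rfl fun p hp => ?_
      rw [← HasAntidiagonal.mem_antidiagonal.1 hp, show 1 + 1 + 2 * p.1 = 2 + 2 * p.1 by omega, sh]
      field_simp
      ring)
  suffices h : n k = q ^ (k+1) * ncF w 0 (2*(k+1)) ∧
      n (k+1) = q ^ (k+2) * ncF w 0 (2*(k+2)) from h.1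
  induction k with
  | zero => exact ⟨by rw [n0]; exact h1.symm, by rw [n1]; exact h2.symm⟩
  | succ k ih =>
    refine ⟨ih.2, ?_⟩
    have e1 := hn k
    have e2 := h3 k
    rw [ih.1, ih.2, ← e2] at e1
    exact mul_left_cancel₀ (by positivity) e1

open Classical in
/-- The pairs (as natural numbers) of a partition. -/
noncomputable def toPairs {n : ℕ} (π : Finpartition (Finset.univ : Finset (Fin n))) :
    Finset (ℕ × ℕ) :=
  ((Finset.univ : Finset (Fin n × Fin n)).filter
    (fun p => p.1 < p.2 ∧ ({p.1, p.2} : Finset (Fin n)) ∈ π.parts)).image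
    (fun p => ((p.1 : ℕ), (p.2 : ℕ)))

lemma mem_toPairs {n : ℕ} (π : Finpartition (Finset.univ : Finset (Fin n))) (x y : ℕ) :
    (x, y) ∈ toPairs π ↔ ∃ (a b : Fin n), (a : ℕ) = x ∧ (b : ℕ) = y ∧ a < b ∧
      ({a, b} : Finset (Fin n)) ∈ π.parts := by
  unfold toPairs
  simp only [mem_image, mem_filter, mem_univ, true_and, Prod.mk.injEq, Prod.exists]
  constructor
  · rintro ⟨a, b, ⟨h1, h2⟩, h3, h4⟩
    exact ⟨a, b, h3, h4, h1, h2⟩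
  · rintro ⟨a, b, h3, h4, h1, h2⟩
    exact ⟨a, b, ⟨h1, h2⟩, h3, h4⟩

lemma pair_eq_lt {n : ℕ} {a b c d : Fin n} (hab : a < b) (hcd : c < d)
    (h : ({a, b} : Finset (Fin n)) = {c, d}) : a = c ∧ b = d := by
  have h1 : a ∈ ({c, d} : Finset (Fin n)) := h ▸ (by simp)
  have h2 : b ∈ ({c, d} : Finset (Fin n)) := h ▸ (by simp)
  simp only [mem_insert, mem_singleton] at h1 h2
  omega

lemma exists_pair {n : ℕ} {B : Finset (Fin n)} (h : B.card = 2) :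
    ∃ a b, a < b ∧ B = {a, b} := by
  rw [Finset.card_eq_two] at h
  obtain ⟨a, b, hab, rfl⟩ := h
  rcases lt_or_gt_of_ne hab with h | h
  · exact ⟨a, b, h, rfl⟩
  · exact ⟨b, a, h, Finset.pair_comm _ _⟩

lemma toPairs_NCM {n : ℕ} (π : Finpartition (Finset.univ : Finset (Fin n)))
    (h1 : IsNoncrossing π) (h2 : ∀ B ∈ π.parts, B.card = 2) : NCM 0 n (toPairs π) := by
  constructor
  · intro x y h
    rw [mem_toPairs] at h
    obtain ⟨a, b, rfl, rfl, hab, -⟩ := h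
    exact ⟨Nat.zero_le _, hab, b.2⟩
  · intro x _ hx
    obtain ⟨B, hB, hxB⟩ := π.exists_mem (Finset.mem_univ (⟨x, hx⟩ : Fin n))
    obtain ⟨a, b, hab, rfl⟩ := exists_pair (h2 B hB)
    simp only [mem_insert, mem_singleton] at hxB
    rcases hxB with h | h
    · exact ⟨b, Or.inl ((mem_toPairs _ _ _).2 ⟨a, b, by rw [← h], rfl, hab, hB⟩)⟩
    · exact ⟨a, Or.inr ((mem_toPairs _ _ _).2 ⟨a, b, rfl, by rw [← h], hab, hB⟩)⟩
  · intro x y z h h'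
    rw [mem_toPairs] at h h'
    obtain ⟨a, b, rfl, rfl, hab, hB⟩ := h
    obtain ⟨c, d, hac, rfl, hcd, hB'⟩ := h'
    obtain rfl := Fin.ext hac
    have := π.eq_of_mem_parts hB hB' (a := c) (by simp) (by simp)
    rw [(pair_eq_lt hab hcd this).2]
  · intro x y z h h'
    rw [mem_toPairs] at h h'
    obtain ⟨a, b, rfl, rfl, hab, hB⟩ := h
    obtain ⟨c, d, rfl, hac, hcd, hB'⟩ := h'
    obtain rfl := Fin.ext hac
    have := π.eq_of_mem_parts hB hB' (a := d) (by simp) (by simp)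
    rw [(pair_eq_lt hab hcd this).1]
  · intro x y z h h'
    rw [mem_toPairs] at h h'
    obtain ⟨a, b, rfl, rfl, hab, hB⟩ := h
    obtain ⟨c, d, hac, rfl, hcd, hB'⟩ := h'
    obtain rfl := Fin.ext hac
    have := π.eq_of_mem_parts hB hB' (a := c) (by simp) (by simp)
    have := (pair_eq_lt hab hcd this).2
    omega
  · intro x y z t hxy hyz hzt h h'
    rw [mem_toPairs] at h h'
    obtain ⟨a, b, rfl, rfl, hab, hB⟩ := h
    obtain ⟨c, d, rfl, rfl, hcd, hB'⟩ := h'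
    have := h1 a c b d hxy hyz hzt _ hB _ hB' (by simp) (by simp) (by simp) (by simp)
    have := (pair_eq_lt hab hcd this).2
    omega

lemma toPairs_inj {n : ℕ} (π π' : Finpartition (Finset.univ : Finset (Fin n)))
    (h2 : ∀ B ∈ π.parts, B.card = 2) (h2' : ∀ B ∈ π'.parts, B.card = 2)
    (h : toPairs π = toPairs π') : π = π' := by
  have key : ∀ a b : Fin n, a < b → (({a, b} : Finset (Fin n)) ∈ π.parts ↔
      ({a, b} : Finset (Fin n)) ∈ π'.parts) := by
    intro a b hab
    have e : ∀ π : Finpartition (Finset.univ : Finset (Fin n)),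
        ({a, b} : Finset (Fin n)) ∈ π.parts ↔ ((a : ℕ), (b : ℕ)) ∈ toPairs π := by
      intro π
      rw [mem_toPairs]
      constructor
      · intro h; exact ⟨a, b, rfl, rfl, hab, h⟩
      · rintro ⟨c, d, h1, h2, _, h4⟩
        rwa [Fin.ext h1, Fin.ext h2] at h4
    rw [e, e, h]
  apply Finpartition.ext
  ext B
  constructor
  · intro hB
    obtain ⟨a, b, hab, rfl⟩ := exists_pair (h2 B hB)
    exact (key a b hab).1 hB
  · intro hB
    obtain ⟨a, b, hab, rfl⟩ := exists_pair (h2' B hB)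
    exact (key a b hab).2 hB

lemma toPairs_surj {n : ℕ} (S : Finset (ℕ × ℕ)) (hS : NCM 0 n S) :
    ∃ π : Finpartition (Finset.univ : Finset (Fin n)), IsNoncrossing π ∧
      (∀ B ∈ π.parts, B.card = 2) ∧ toPairs π = S := by
  classical
  let parts : Finset (Finset (Fin n)) := Finset.univ.filter fun B =>
    ∃ a b : Fin n, ((a : ℕ), (b : ℕ)) ∈ S ∧ B = {a, b}
  have hp : ∀ B, B ∈ parts ↔ ∃ a b : Fin n, ((a : ℕ), (b : ℕ)) ∈ S ∧ B = {a, b} := by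
    intro B; simp [parts]
  have huniq : ∀ a b c d x : Fin n, ((a : ℕ), (b : ℕ)) ∈ S → ((c : ℕ), (d : ℕ)) ∈ S →
      (x = a ∨ x = b) → (x = c ∨ x = d) → a = c ∧ b = d := by
    intro a b c d x h1 h2 h3 h4
    rcases h3 with rfl | rfl <;> rcases h4 with rfl | rfl
    · exact ⟨rfl, Fin.ext (hS.fst _ _ _ h1 h2)⟩
    · exact absurd h1 (hS.dis _ _ _ h2)
    · exact absurd h2 (hS.dis _ _ _ h1)
    · exact ⟨Fin.ext (hS.snd _ _ _ h1 h2), rfl⟩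
  let π : Finpartition (Finset.univ : Finset (Fin n)) :=
    Finpartition.ofExistsUnique parts (fun p _ => Finset.subset_univ p) (by
      intro x _
      obtain ⟨y, hy⟩ := hS.cov x (Nat.zero_le _) x.2
      rcases hy with hy | hy
      · have hyn := (hS.mem _ _ hy).2.2
        refine ⟨{x, ⟨y, hyn⟩}, ⟨(hp _).2 ⟨x, ⟨y, hyn⟩, hy, rfl⟩, by simp⟩, ?_⟩
        rintro B ⟨hB, hxB⟩
        obtain ⟨c, d, hcd, rfl⟩ := (hp _).1 hB
        simp only [mem_insert, mem_singleton] at hxB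
        obtain ⟨rfl, rfl⟩ := huniq x ⟨y, hyn⟩ c d x hy hcd (Or.inl rfl) hxB
        rfl
      · have hyn : y < n := lt_trans (hS.mem _ _ hy).2.1 x.2
        refine ⟨{⟨y, hyn⟩, x}, ⟨(hp _).2 ⟨⟨y, hyn⟩, x, hy, rfl⟩, by simp⟩, ?_⟩
        rintro B ⟨hB, hxB⟩
        obtain ⟨c, d, hcd, rfl⟩ := (hp _).1 hB
        simp only [mem_insert, mem_singleton] at hxB
        obtain ⟨rfl, rfl⟩ := huniq ⟨y, hyn⟩ x c d x hy hcd (Or.inr rfl) hxB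
        rfl) (by
      intro h
      obtain ⟨c, d, hcd, h⟩ := (hp _).1 h
      have : c ∈ (∅ : Finset (Fin n)) := h ▸ (by simp)
      simp at this)
  have hπ : ∀ B, B ∈ π.parts ↔ ∃ a b : Fin n, ((a : ℕ), (b : ℕ)) ∈ S ∧ B = {a, b} := hp
  refine ⟨π, ?_, ?_, ?_⟩
  · intro a b c d hab hbc hcd B₁ hB₁ B₂ hB₂ ha hc hb hd
    exfalso
    obtain ⟨x, y, hxy, rfl⟩ := (hπ _).1 hB₁
    obtain ⟨z, t, hzt, rfl⟩ := (hπ _).1 hB₂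
    have l1 := (hS.mem _ _ hxy).2.1
    have l2 := (hS.mem _ _ hzt).2.1
    simp only [mem_insert, mem_singleton] at ha hb hc hd
    obtain ⟨rfl, rfl⟩ : a = x ∧ c = y := by omega
    obtain ⟨rfl, rfl⟩ : b = z ∧ d = t := by omega
    exact hS.nc _ _ _ _ hab hbc hcd hxy hzt
  · intro B hB
    obtain ⟨x, y, hxy, rfl⟩ := (hπ _).1 hB
    have l1 := (hS.mem _ _ hxy).2.1
    exact Finset.card_pair (by rintro rfl; omega)
  · ext ⟨x, y⟩
    rw [mem_toPairs]
    constructor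
    · rintro ⟨a, b, rfl, rfl, hab, h⟩
      obtain ⟨c, d, hcd, h⟩ := (hπ _).1 h
      obtain ⟨rfl, rfl⟩ := pair_eq_lt hab (hS.mem _ _ hcd).2.1 h
      exact hcd
    · intro h
      have l := hS.mem _ _ h
      exact ⟨⟨x, by omega⟩, ⟨y, by omega⟩, rfl, rfl, l.2.1, (hπ _).2 ⟨⟨x, by omega⟩, ⟨y, by omega⟩, h, rfl⟩⟩

lemma toPairs_weight {n : ℕ} (q : ℝ) (π : Finpartition (Finset.univ : Finset (Fin n)))
    (h2 : ∀ B ∈ π.parts, B.card = 2) :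
    q ^ (-(evenCnt π : ℤ)) = ∏ p ∈ toPairs π, (if Even p.1 then 1 else q⁻¹) := by
  classical
  have e : evenCnt π = ((toPairs π).filter fun p => ¬ Even p.1).card := by
    unfold evenCnt
    symm
    have hmem : ∀ p ∈ toPairs π, p.1 < n ∧ p.2 < n := by
      rintro ⟨x, y⟩ hp
      obtain ⟨a, b, rfl, rfl, hab, h⟩ := (mem_toPairs _ _ _).1 hp
      exact ⟨a.2, b.2⟩
    refine Finset.card_bij (fun p hp => {⟨p.1, (hmem p (mem_filter.1 hp).1).1⟩,
      ⟨p.2, (hmem p (mem_filter.1 hp).1).2⟩}) ?_ ?_ ?_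
    · rintro ⟨x, y⟩ hp
      rw [mem_filter, mem_toPairs] at hp
      obtain ⟨⟨a, b, rfl, rfl, hab, h⟩, hev⟩ := hp
      rw [mem_filter]
      refine ⟨h, a, by simp, by simpa [Nat.even_add_one] using hev, ?_⟩
      intro x hx
      simp only [mem_insert, mem_singleton] at hx
      rcases hx with rfl | rfl
      · exact le_rfl
      · exact hab.le
    · rintro ⟨x, y⟩ hp ⟨x', y'⟩ hp' h
      rw [mem_filter, mem_toPairs] at hp hp'
      obtain ⟨⟨a, b, rfl, rfl, hab, -⟩, -⟩ := hp
      obtain ⟨⟨c, d, rfl, rfl, hcd, -⟩, -⟩ := hp'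
      obtain ⟨rfl, rfl⟩ := pair_eq_lt hab hcd h
      rfl
    · intro B hB
      rw [mem_filter] at hB
      obtain ⟨hB, y, hy, hev, hmin⟩ := hB
      obtain ⟨a, b, hab, rfl⟩ := exists_pair (h2 B hB)
      have : y = a := by
        have := hmin a (by simp)
        simp only [mem_insert, mem_singleton] at hy
        omega
      subst this
      refine ⟨(y, b), ?_, rfl⟩
      rw [mem_filter, mem_toPairs]
      exact ⟨⟨y, b, rfl, rfl, hab, hB⟩, by simpa [Nat.even_add_one] using hev⟩
  rw [Finset.prod_ite, Finset.prod_const_one, one_mul, Finset.prod_const, e, zpow_neg, zpow_natCast,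
    inv_pow]

lemma sum_ncPair (q : ℝ) (n : ℕ) : ∑ π ∈ ncPairPartitions n, q ^ (-(evenCnt π : ℤ)) =
    ncF (fun m => if Even m then 1 else q⁻¹) 0 n := by
  unfold ncF
  have hm : ∀ π : Finpartition (Finset.univ : Finset (Fin n)), π ∈ ncPairPartitions n ↔
      IsNoncrossing π ∧ ∀ B ∈ π.parts, B.card = 2 := by
    intro π; simp [ncPairPartitions]
  refine Finset.sum_bij (fun π _ => toPairs π) ?_ ?_ ?_ ?_
  · intro π h
    rw [hm] at h
    exact (mem_ncM _ _ _).2 (toPairs_NCM π h.1 h.2)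
  · intro π h π' h' e
    rw [hm] at h h'
    exact toPairs_inj π π' h.2 h'.2 e
  · intro S h
    obtain ⟨π, h1, h2, h3⟩ := toPairs_surj S ((mem_ncM _ _ _).1 h)
    exact ⟨π, (hm _).2 ⟨h1, h2⟩, h3⟩
  · intro π h
    rw [hm] at h
    exact toPairs_weight q π h.2

/-- Reduction of the even sum with `κ = δ` to pair partitions. -/
lemma sum_ncEven_delta (q σ : ℝ) (k : ℕ) (κ : ℕ → ℝ) (h1 : κ 1 = σ ^ 2)
    (h2 : ∀ l, 2 ≤ l → κ l = 0) :
    ∑ π ∈ ncEvenPartitions (2 * k), q ^ (-(evenCnt π : ℤ)) * ∏ B ∈ π.parts, κ (B.card / 2) =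
      σ ^ (2 * k) * ∑ π ∈ ncPairPartitions (2 * k), q ^ (-(evenCnt π : ℤ)) := by
  classical
  rw [Finset.mul_sum]
  symm
  have hsub : ncPairPartitions (2 * k) ⊆ ncEvenPartitions (2 * k) := by
    intro π h
    simp only [ncPairPartitions, ncEvenPartitions, mem_filter, mem_univ, true_and] at h ⊢
    exact ⟨h.1, fun B hB => by rw [h.2 B hB]; decide⟩
  rw [← Finset.sum_subset hsub (f := fun π => q ^ (-(evenCnt π : ℤ)) * ∏ B ∈ π.parts, κ (B.card / 2))]
  · refine Finset.sum_congr rfl fun π h => ?_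
    simp only [ncPairPartitions, mem_filter, mem_univ, true_and] at h
    have hc : π.parts.card = k := by
      have := π.sum_card_parts
      rw [Finset.sum_congr rfl h.2] at this
      simp at this
      omega
    rw [Finset.prod_congr rfl (fun B hB => by rw [h.2 B hB] : ∀ B ∈ π.parts, κ (B.card / 2) = κ (2/2))]
    rw [Finset.prod_const, hc]
    norm_num
    rw [h1, ← pow_mul, mul_comm]
  · intro π h h'
    simp only [ncPairPartitions, ncEvenPartitions, mem_filter, mem_univ, true_and] at h h'
    have : ∃ B ∈ π.parts, B.card ≠ 2 := by
      by_contra hcon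
      push Not at hcon
      exact h' ⟨h.1, hcon⟩
    obtain ⟨B, hB, hB2⟩ := this
    rw [Finset.prod_eq_zero hB, mul_zero]
    apply h2
    have e := h.2 B hB
    have := (π.nonempty_of_mem_parts hB).card_pos
    obtain ⟨m, hm⟩ := e
    omega

lemma cumulant_unique (q : ℝ) (hq : 0 < q) (κ κ' : ℕ → ℝ)
    (h : ∀ k : ℕ, 1 ≤ k →
      ∑ π ∈ ncEvenPartitions (2 * k), q ^ (-(evenCnt π : ℤ)) * ∏ B ∈ π.parts, κ (B.card / 2) =
      ∑ π ∈ ncEvenPartitions (2 * k), q ^ (-(evenCnt π : ℤ)) * ∏ B ∈ π.parts, κ' (B.card / 2)) :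
    ∀ l : ℕ, 1 ≤ l → κ l = κ' l := by
  classical
  intro l
  induction l using Nat.strong_induction_on with
  | _ l ih =>
  intro hl
  have hne : (Finset.univ : Finset (Fin (2 * l))) ≠ ⊥ := by
    have : Nonempty (Fin (2 * l)) := ⟨⟨0, by omega⟩⟩
    exact Finset.univ_nonempty.ne_empty
  set T : Finpartition (Finset.univ : Finset (Fin (2 * l))) := Finpartition.indiscrete hne with hT
  have hTp : T.parts = {Finset.univ} := rfl
  have hTm : T ∈ ncEvenPartitions (2 * l) := by
    simp only [ncEvenPartitions, mem_filter, mem_univ, true_and]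
    constructor
    · intro a b c d _ _ _ B₁ h1 B₂ h2 _ _ _ _
      rw [hTp, mem_singleton] at h1 h2
      rw [h1, h2]
    · intro B hB
      rw [hTp, mem_singleton] at hB
      rw [hB]; simp
  have hsum := h l hl
  rw [← Finset.add_sum_erase _ _ hTm, ← Finset.add_sum_erase (ncEvenPartitions (2 * l)) (fun π =>
    q ^ (-(evenCnt π : ℤ)) * ∏ B ∈ π.parts, κ' (B.card / 2)) hTm] at hsum
  have heq : ∑ π ∈ (ncEvenPartitions (2 * l)).erase T,
      q ^ (-(evenCnt π : ℤ)) * ∏ B ∈ π.parts, κ (B.card / 2) =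
      ∑ π ∈ (ncEvenPartitions (2 * l)).erase T,
      q ^ (-(evenCnt π : ℤ)) * ∏ B ∈ π.parts, κ' (B.card / 2) := by
    refine Finset.sum_congr rfl fun π hπ => ?_
    rw [mem_erase] at hπ
    congr 1
    refine Finset.prod_congr rfl fun B hB => ?_
    have hpos := (π.nonempty_of_mem_parts hB).card_pos
    have hev : Even B.card := by
      have := hπ.2
      simp only [ncEvenPartitions, mem_filter, mem_univ, true_and] at this
      exact this.2 B hB
    have hle : B.card ≤ 2 * l := by simpa using Finset.card_le_univ B
    have hlt : B.card ≠ 2 * l := by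
      intro hc
      have hBu : B = Finset.univ := by
        rw [← Finset.card_eq_iff_eq_univ]; simpa using hc
      apply hπ.1
      apply Finpartition.ext
      rw [hTp]
      ext C
      rw [mem_singleton]
      constructor
      · intro hC
        obtain ⟨x, hx⟩ := π.nonempty_of_mem_parts hC
        rw [← hBu]
        exact π.eq_of_mem_parts hC hB hx (by rw [hBu]; simp)
      · rintro rfl; rwa [hBu] at hB
    obtain ⟨m, hm⟩ := hev
    exact ih _ (by omega) (by omega)
  rw [heq] at hsum
  have hsum := add_right_cancel hsum
  rw [hTp, Finset.prod_singleton, Finset.prod_singleton] at hsum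
  have := mul_left_cancel₀ (zpow_pos hq _).ne' hsum
  simpa using this

lemma rg_s_pos (q θ : ℝ) (hq : 1 ≤ q) (hθ : θ ∈ Set.Ioo 0 Real.pi) :
    0 < q + 1 - 2 * Real.sqrt q * Real.cos θ := by
  have h1 : 0 < Real.sin θ := Real.sin_pos_of_pos_of_lt_pi hθ.1 hθ.2
  have h2 := Real.sin_sq_add_cos_sq θ
  have h3 : Real.sqrt q ^ 2 = q := Real.sq_sqrt (by linarith)
  nlinarith [sq_nonneg (Real.sqrt q - Real.cos θ), pow_pos h1 2]

lemma rg_image (q σ : ℝ) (hq : 1 ≤ q) (hσ : 0 < σ) :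
    (fun θ => σ / Real.sqrt q * Real.sqrt (q + 1 - 2 * Real.sqrt q * Real.cos θ)) '' Set.Ioo 0 Real.pi
     = Set.Ioo ((1 - (Real.sqrt q)⁻¹) * σ) ((1 + (Real.sqrt q)⁻¹) * σ) := by
  have hr1 : 1 ≤ Real.sqrt q := Real.one_le_sqrt.2 hq
  have h3 : Real.sqrt q ^ 2 = q := Real.sq_sqrt (by linarith)
  have hs := fun θ hθ => rg_s_pos q θ hq hθ
  generalize Real.sqrt q = r at *
  have hr0 : 0 < r := by linarith
  have ea : (1 - r⁻¹) * σ = σ / r * (r - 1) := by field_simp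
  have eb : (1 + r⁻¹) * σ = σ / r * (r + 1) := by field_simp
  rw [ea, eb]
  have hσr : 0 < σ / r := by positivity
  ext x
  simp only [Set.mem_image, Set.mem_Ioo]
  constructor
  · rintro ⟨θ, ⟨h0, h1⟩, rfl⟩
    have hc1 : Real.cos θ < 1 := by
      rw [← Real.cos_zero]
      exact Real.cos_lt_cos_of_nonneg_of_le_pi le_rfl h1.le h0
    have hc2 : -1 < Real.cos θ := by
      rw [← Real.cos_pi]
      exact Real.cos_lt_cos_of_nonneg_of_le_pi h0.le le_rfl h1
    constructor
    · apply mul_lt_mul_of_pos_left _ hσr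
      apply Real.lt_sqrt_of_sq_lt
      nlinarith
    · apply mul_lt_mul_of_pos_left _ hσr
      rw [Real.sqrt_lt' (by linarith)]
      nlinarith
  · rintro ⟨h1, h2⟩
    set y := x / (σ / r) with hy
    have hx : x = σ / r * y := by rw [hy]; field_simp
    rw [hx] at h1 h2 ⊢
    have h1 := lt_of_mul_lt_mul_left h1 hσr.le
    have h2 := lt_of_mul_lt_mul_left h2 hσr.le
    have hy0 : 0 < y := by linarith
    set c := (q + 1 - y ^ 2) / (2 * r) with hc
    have hyc : 2 * r * c = q + 1 - y ^ 2 := by rw [hc]; field_simp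
    have c1 : c < 1 := by rw [hc, div_lt_one (by linarith)]; nlinarith
    have c2 : -1 < c := by rw [hc, lt_div_iff₀ (by linarith)]; nlinarith
    refine ⟨Real.arccos c, ⟨Real.arccos_pos.2 c1, ?_⟩, ?_⟩
    · rw [← Real.arccos_neg_one]
      exact Real.strictAntiOn_arccos ⟨le_rfl, by norm_num⟩ ⟨c2.le, c1.le⟩ c2
    · rw [Real.cos_arccos c2.le c1.le, hyc, sub_sub_cancel, Real.sqrt_sq hy0.le]

lemma rg_injOn (q σ : ℝ) (hq : 1 ≤ q) (hσ : 0 < σ) :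
    Set.InjOn (fun θ => σ / Real.sqrt q * Real.sqrt (q + 1 - 2 * Real.sqrt q * Real.cos θ))
      (Set.Ioo 0 Real.pi) := by
  have hr1 : 1 ≤ Real.sqrt q := Real.one_le_sqrt.2 hq
  have hs := fun θ hθ => rg_s_pos q θ hq hθ
  generalize Real.sqrt q = r at *
  intro x hx y hy h
  have hσr : σ / r ≠ 0 := by positivity
  have h := mul_left_cancel₀ hσr h
  rw [Real.sqrt_inj (hs x hx).le (hs y hy).le] at h
  have : Real.cos x = Real.cos y := by
    have : 2 * r * (Real.cos x - Real.cos y) = 0 := by linarith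
    rcases mul_eq_zero.1 this with h | h <;> linarith
  exact Real.injOn_cos ⟨hx.1.le, hx.2.le⟩ ⟨hy.1.le, hy.2.le⟩ this

lemma rg_subst (q σ : ℝ) (hq : 1 ≤ q) (hσ : 0 < σ) (k : ℕ) :
    ∫ x in Set.Ioo ((1 - (Real.sqrt q)⁻¹) * σ) ((1 + (Real.sqrt q)⁻¹) * σ),
      rectGaussDensity q σ x * x ^ (2 * k) =
    ∫ θ in Set.Ioo 0 Real.pi, (σ ^ 2 / q) ^ k * (q / Real.pi) *
      ((q + 1 - 2 * Real.sqrt q * Real.cos θ) ^ k * Real.sin θ ^ 2 /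
        (q + 1 - 2 * Real.sqrt q * Real.cos θ)) := by
  have hr1 : 1 ≤ Real.sqrt q := Real.one_le_sqrt.2 hq
  have h3 : Real.sqrt q ^ 2 = q := Real.sq_sqrt (by linarith)
  rw [← rg_image q σ hq hσ]
  rw [integral_image_eq_integral_abs_deriv_smul measurableSet_Ioo
    (f' := fun θ => σ * Real.sin θ / Real.sqrt (q + 1 - 2 * Real.sqrt q * Real.cos θ)) ?_
    (rg_injOn q σ hq hσ)]
  · refine setIntegral_congr_fun measurableSet_Ioo fun θ hθ => ?_
    have hin : σ / Real.sqrt q * Real.sqrt (q + 1 - 2 * Real.sqrt q * Real.cos θ) ∈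
        Set.Ioo ((1 - (Real.sqrt q)⁻¹) * σ) ((1 + (Real.sqrt q)⁻¹) * σ) := by
      rw [← rg_image q σ hq hσ]
      exact ⟨θ, hθ, rfl⟩
    have hs := rg_s_pos q θ hq hθ
    have hsin : 0 < Real.sin θ := Real.sin_pos_of_pos_of_lt_pi hθ.1 hθ.2
    simp only [smul_eq_mul]
    rw [rectGaussDensity, if_pos (Set.mem_union_right _ (Set.Ioo_subset_Icc_self hin))]
    have hS : Real.sqrt (q + 1 - 2 * Real.sqrt q * Real.cos θ) ^ 2 =
      q + 1 - 2 * Real.sqrt q * Real.cos θ := Real.sq_sqrt hs.le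
    have hSp : 0 < Real.sqrt (q + 1 - 2 * Real.sqrt q * Real.cos θ) := Real.sqrt_pos.2 hs
    have hsc := Real.sin_sq_add_cos_sq θ
    clear hin
    generalize hs' : q + 1 - 2 * Real.sqrt q * Real.cos θ = s at *
    generalize Real.sqrt s = S at *
    generalize Real.sqrt q = r at *
    have hr0 : 0 < r := by linarith
    have hW : 4 * q * σ ^ 4 - (q * (σ / r * S) ^ 2 - (q + 1) * σ ^ 2) ^ 2 =
        (2 * r * σ ^ 2 * Real.sin θ) ^ 2 := by
      have e1 : q * (σ / r * S) ^ 2 = σ ^ 2 * s := by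
        rw [mul_pow, div_pow, h3, hS]; field_simp
      rw [e1, show σ ^ 2 * s - (q + 1) * σ ^ 2 = - (2 * r * Real.cos θ) * σ ^ 2 by rw [← hs']; ring]
      linear_combination (-4 * σ^4 ) * h3 + (4 * r^2 * σ^4) * hsc * (-1)
    rw [hW, Real.sqrt_sq (by positivity), abs_of_pos (by positivity : 0 < σ * Real.sin θ / S),
      abs_of_pos (by positivity : 0 < σ / r * S)]
    have e2 : (σ / r * S) ^ (2 * k) = (σ ^ 2 / q) ^ k * s ^ k := by
      rw [pow_mul, mul_pow, div_pow, h3, hS, mul_pow]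
    rw [e2, ← h3, ← hS]
    field_simp
  · intro θ hθ
    have hs := rg_s_pos q θ hq hθ
    have h1 : HasDerivAt (fun θ => q + 1 - 2 * Real.sqrt q * Real.cos θ)
        (2 * Real.sqrt q * Real.sin θ) θ := by
      have := ((Real.hasDerivAt_cos θ).const_mul (2 * Real.sqrt q)).const_sub (q + 1)
      refine HasDerivAt.congr_deriv this ?_
      ring
    have h2 := (h1.sqrt hs.ne').const_mul (σ / Real.sqrt q)
    refine HasDerivAt.hasDerivWithinAt ?_
    refine HasDerivAt.congr_deriv h2 ?_
    field_simp

lemma rg_even (q σ x : ℝ) : rectGaussDensity q σ (-x) = rectGaussDensity q σ x := by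
  unfold rectGaussDensity
  have : (-x ∈ Set.Icc (-((1 + (Real.sqrt q)⁻¹) * σ)) (-((1 - (Real.sqrt q)⁻¹) * σ)) ∪
       Set.Icc ((1 - (Real.sqrt q)⁻¹) * σ) ((1 + (Real.sqrt q)⁻¹) * σ)) ↔
       (x ∈ Set.Icc (-((1 + (Real.sqrt q)⁻¹) * σ)) (-((1 - (Real.sqrt q)⁻¹) * σ)) ∪
       Set.Icc ((1 - (Real.sqrt q)⁻¹) * σ) ((1 + (Real.sqrt q)⁻¹) * σ)) := by
    simp only [Set.mem_union, Set.mem_Icc]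
    constructor
    · rintro (⟨h, h'⟩ | ⟨h, h'⟩)
      · right; constructor <;> linarith
      · left; constructor <;> linarith
    · rintro (⟨h, h'⟩ | ⟨h, h'⟩)
      · right; constructor <;> linarith
      · left; constructor <;> linarith
  simp only [this, neg_sq, abs_neg]

lemma rg_abs (q σ x : ℝ) : rectGaussDensity q σ |x| = rectGaussDensity q σ x := by
  rcases abs_choice x with h | h <;> rw [h]
  exact rg_even q σ x

lemma rg_meas (q σ : ℝ) : Measurable (rectGaussDensity q σ) := by
  unfold rectGaussDensity
  refine Measurable.ite (measurableSet_Icc.union measurableSet_Icc) ?_ measurable_const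
  fun_prop

lemma rg_nonneg (q σ x : ℝ) : 0 ≤ rectGaussDensity q σ x := by
  unfold rectGaussDensity
  split_ifs
  · positivity
  · exact le_rfl

lemma rg_full (q σ : ℝ) (hq : 1 ≤ q) (hσ : 0 < σ) (k : ℕ) :
    ∫ x, rectGaussDensity q σ x * x ^ (2 * k) =
    (σ ^ 2 / q) ^ k * (2 * q / Real.pi * ∫ θ in (0:ℝ)..Real.pi,
      ((q + 1 - 2 * Real.sqrt q * Real.cos θ) ^ k * Real.sin θ ^ 2 /
        (q + 1 - 2 * Real.sqrt q * Real.cos θ))) := by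
  have h1 : ∀ x : ℝ, rectGaussDensity q σ x * x ^ (2 * k) =
      (fun x => rectGaussDensity q σ x * x ^ (2 * k)) |x| := by
    intro x
    simp only [rg_abs, pow_mul, sq_abs]
  rw [integral_congr_ae (Filter.Eventually.of_forall h1), integral_comp_abs
    (f := fun x => rectGaussDensity q σ x * x ^ (2 * k))]
  have hr1 : 1 ≤ Real.sqrt q := Real.one_le_sqrt.2 hq
  have hα : 0 ≤ (1 - (Real.sqrt q)⁻¹) * σ := 
    mul_nonneg (sub_nonneg.2 (inv_le_one_of_one_le₀ hr1)) hσ.le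
  have h2 : ∫ x in Set.Ioi 0, rectGaussDensity q σ x * x ^ (2 * k) =
      ∫ x in Set.Ioo ((1 - (Real.sqrt q)⁻¹) * σ) ((1 + (Real.sqrt q)⁻¹) * σ),
      rectGaussDensity q σ x * x ^ (2 * k) := by
    apply setIntegral_eq_of_subset_of_ae_sdiff_eq_zero measurableSet_Ioi.nullMeasurableSet
    · intro x hx
      exact lt_of_le_of_lt hα hx.1
    · have e1 : ∀ᵐ x : ℝ, x ≠ (1 - (Real.sqrt q)⁻¹) * σ := by
        simp [ae_iff]
      have e2 : ∀ᵐ x : ℝ, x ≠ (1 + (Real.sqrt q)⁻¹) * σ := by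
        simp [ae_iff]
      filter_upwards [e1, e2] with x hx1 hx2 hx
      rw [rectGaussDensity, if_neg, zero_mul]
      rintro (h | h)
      · have := h.2
        have := hx.1
        simp only [Set.mem_Ioi] at this
        linarith
      · exact hx.2 ⟨lt_of_le_of_ne h.1 hx1.symm, lt_of_le_of_ne h.2 hx2⟩
  rw [h2, rg_subst q σ hq hσ k, integral_const_mul, intervalIntegral.integral_of_le Real.pi_pos.le,
    integral_Ioc_eq_integral_Ioo]
  ring

lemma rg_integral (q σ : ℝ) (g : ℝ → ℝ) :
    ∫ x, g x ∂(rectGauss q σ) = ∫ x, rectGaussDensity q σ x * g x := by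
  unfold rectGauss
  rw [integral_withDensity_eq_integral_toReal_smul (rg_meas q σ).ennreal_ofReal
    (Filter.Eventually.of_forall fun x => ENNReal.ofReal_lt_top)]
  simp only [ENNReal.toReal_ofReal (rg_nonneg q σ _), smul_eq_mul]

lemma rg_zero (q : ℝ) (hq : 1 ≤ q) : 2 * q / Real.pi * ∫ θ in (0:ℝ)..Real.pi,
      ((q + 1 - 2 * Real.sqrt q * Real.cos θ) ^ 0 * Real.sin θ ^ 2 /
        (q + 1 - 2 * Real.sqrt q * Real.cos θ)) = 1 := by
  have hr1 : 1 ≤ Real.sqrt q := Real.one_le_sqrt.2 hq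
  have h3 : Real.sqrt q ^ 2 = q := Real.sq_sqrt (by linarith)
  have hI : ∫ θ in (0:ℝ)..Real.pi, (q - 1) / (q + 1 - 2 * Real.sqrt q * Real.cos θ) * (q - 1)
      = Real.pi * (q - 1) := by
    rcases hq.eq_or_lt with rfl | hq1
    · simp
    rw [intervalIntegral.integral_mul_const]
    congr 1
    have hr2 : 1 < Real.sqrt q := by rw [Real.lt_sqrt (by norm_num)]; linarith
    have hrc : ∀ θ, 0 < Real.sqrt q - Real.cos θ := fun θ => by linarith [Real.cos_le_one θ]
    have hs : ∀ θ, 0 < q + 1 - 2 * Real.sqrt q * Real.cos θ := fun θ => by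
      nlinarith [Real.sin_sq_add_cos_sq θ, pow_pos (hrc θ) 2, sq_nonneg (Real.sin θ)]
    rw [intervalIntegral.integral_eq_sub_of_hasDerivAt
      (f := fun θ => θ + 2 * Real.arctan (Real.sin θ / (Real.sqrt q - Real.cos θ)))]
    · simp
    · intro θ _
      have d1 := (Real.hasDerivAt_sin θ).div ((Real.hasDerivAt_cos θ).const_sub (Real.sqrt q))
        (hrc θ).ne'
      have d2 := (hasDerivAt_id θ).add (d1.arctan.const_mul 2)
      refine HasDerivAt.congr_deriv (show HasDerivAt (fun θ => θ + 2 * Real.arctan (Real.sin θ /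
        (Real.sqrt q - Real.cos θ))) _ θ from d2) ?_
      have := hs θ
      have h4 := Real.sin_sq_add_cos_sq θ
      have h5 := hrc θ
      simp only [Pi.div_apply]
      have h6 : 1 + (Real.sin θ / (Real.sqrt q - Real.cos θ)) ^ 2 =
        (q + 1 - 2 * Real.sqrt q * Real.cos θ) / (Real.sqrt q - Real.cos θ) ^ 2 := by
        field_simp
        linear_combination h4 + h3
      rw [h6]
      field_simp
      linear_combination (-2) * h4
    · apply Continuous.intervalIntegrable
      exact Continuous.div (by fun_prop) (by fun_prop) (fun θ => (hs θ).ne')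
  have hcont : IntervalIntegrable (fun θ => (q - 1) / (q + 1 - 2 * Real.sqrt q * Real.cos θ) * (q - 1))
      volume 0 Real.pi := by
    rcases hq.eq_or_lt with rfl | hq1
    · simp
    by_contra hcon
    rw [intervalIntegral.integral_undef hcon] at hI
    have : 0 < Real.pi * (q - 1) := mul_pos Real.pi_pos (by linarith)
    linarith
  have hE : ∫ θ in (0:ℝ)..Real.pi, ((q + 1 - 2 * Real.sqrt q * Real.cos θ) ^ 0 * Real.sin θ ^ 2 /
        (q + 1 - 2 * Real.sqrt q * Real.cos θ)) = 
      ∫ θ in (0:ℝ)..Real.pi, (4 * q)⁻¹ * ((q + 1 + 2 * Real.sqrt q * Real.cos θ) -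
        (q - 1) / (q + 1 - 2 * Real.sqrt q * Real.cos θ) * (q - 1)) := by
    rw [intervalIntegral.integral_of_le Real.pi_pos.le, integral_Ioc_eq_integral_Ioo,
      intervalIntegral.integral_of_le Real.pi_pos.le, integral_Ioc_eq_integral_Ioo]
    refine setIntegral_congr_fun measurableSet_Ioo fun θ hθ => ?_
    have hs := rg_s_pos q θ hq hθ
    have h4 := Real.sin_sq_add_cos_sq θ
    have hq0 : 0 < q := by linarith
    simp only [pow_zero, one_mul]
    field_simp
    linear_combination (4 * q) * h4 + (-4 * Real.cos θ ^ 2) * h3 * (-1)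
  rw [hE, intervalIntegral.integral_const_mul, intervalIntegral.integral_sub _ hcont, hI,
    intervalIntegral.integral_add, intervalIntegral.integral_const_mul]
  · simp
    have := Real.pi_pos
    field_simp
    ring
  · exact Continuous.intervalIntegrable (by fun_prop) _ _
  · exact Continuous.intervalIntegrable (by fun_prop) _ _
  · exact Continuous.intervalIntegrable (by fun_prop) _ _

/-- The rescaled shifted moments. -/
noncomputable def rgN (q : ℝ) (j : ℕ) : ℝ := 2 * q / Real.pi * ∫ θ in (0:ℝ)..Real.pi,
      (q + 1 - 2 * Real.sqrt q * Real.cos θ) ^ j * Real.sin θ ^ 2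

lemma rgN_int (q : ℝ) (j : ℕ) : IntervalIntegrable (fun θ =>
    (q + 1 - 2 * Real.sqrt q * Real.cos θ) ^ j * Real.sin θ ^ 2) volume 0 Real.pi :=
  Continuous.intervalIntegrable (by fun_prop) _ _

lemma rgN_zero (q : ℝ) : rgN q 0 = q := by
  unfold rgN
  simp only [pow_zero, one_mul, integral_sin_sq]
  have := Real.pi_pos
  simp
  field_simp

lemma rgN_one (q : ℝ) (hq : 1 ≤ q) : rgN q 1 = (q + 1) * q := by
  have h := intervalIntegral.integral_eq_sub_of_hasDerivAt (a := 0) (b := Real.pi)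
    (f := fun θ => Real.sin θ ^ 3) (f' := fun θ => 3 * Real.sin θ ^ 2 * Real.cos θ)
    (fun θ _ => by
      refine HasDerivAt.congr_deriv ((Real.hasDerivAt_sin θ).pow 3) ?_
      norm_num)
    (Continuous.intervalIntegrable (by fun_prop) _ _)
  simp at h
  have e : rgN q 1 - (q + 1) * rgN q 0 = 0 := by
    unfold rgN
    have : ∫ θ in (0:ℝ)..Real.pi, (((q + 1 - 2 * Real.sqrt q * Real.cos θ) ^ 1 * Real.sin θ ^ 2) -
      (q + 1) * ((q + 1 - 2 * Real.sqrt q * Real.cos θ) ^ 0 * Real.sin θ ^ 2)) =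
      ∫ θ in (0:ℝ)..Real.pi, (-2 * Real.sqrt q / 3) * (3 * Real.sin θ ^ 2 * Real.cos θ) := by
      congr 1; ext θ; ring
    rw [intervalIntegral.integral_const_mul, h, intervalIntegral.integral_sub (rgN_int q 1)
      ((rgN_int q 0).const_mul _), intervalIntegral.integral_const_mul] at this
    linear_combination (2 * q / Real.pi) * this
  rw [rgN_zero] at e
  linarith

lemma rgN_rec (q : ℝ) (hq : 1 ≤ q) (j : ℕ) : ((j:ℝ)+4) * rgN q (j+2) =
      (2*j+5)*(q+1)*rgN q (j+1) - (j+1)*((q+1)^2-4*q)*rgN q j := by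
  have h3 : Real.sqrt q ^ 2 = q := Real.sq_sqrt (by linarith)
  have h := intervalIntegral.integral_eq_sub_of_hasDerivAt (a := 0) (b := Real.pi)
    (f := fun θ => 2 * Real.sqrt q * ((q + 1 - 2 * Real.sqrt q * Real.cos θ) ^ (j+1) * Real.sin θ ^ 3))
    (f' := fun θ => ((2*j+5)*(q+1) * ((q + 1 - 2 * Real.sqrt q * Real.cos θ) ^ (j+1) * Real.sin θ ^ 2)
      - (j+1)*((q+1)^2-4*q) * ((q + 1 - 2 * Real.sqrt q * Real.cos θ) ^ j * Real.sin θ ^ 2))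
      - ((j:ℝ)+4) * ((q + 1 - 2 * Real.sqrt q * Real.cos θ) ^ (j+2) * Real.sin θ ^ 2))
    (fun θ _ => by
      have h1 : HasDerivAt (fun θ => q + 1 - 2 * Real.sqrt q * Real.cos θ)
          (2 * Real.sqrt q * Real.sin θ) θ := by
        have := ((Real.hasDerivAt_cos θ).const_mul (2 * Real.sqrt q)).const_sub (q + 1)
        refine HasDerivAt.congr_deriv this ?_
        ring
      refine HasDerivAt.congr_deriv
        (((h1.pow (j+1)).mul ((Real.hasDerivAt_sin θ).pow 3)).const_mul (2 * Real.sqrt q)) ?_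
      simp only [Pi.pow_apply, Nat.add_sub_cancel]
      have h4 := Real.sin_sq_add_cos_sq θ
      push_cast
      have h5 : Real.sin θ ^ 4 = Real.sin θ ^ 2 * (1 - Real.cos θ ^ 2) := by
        rw [← h4]; ring
      generalize hs : q + 1 - 2 * Real.sqrt q * Real.cos θ = s
      have hc : 2 * Real.sqrt q * Real.cos θ = q + 1 - s := by rw [← hs]; ring
      have h6 : 4 * q * Real.sin θ ^ 4 = Real.sin θ ^ 2 * (4 * q - (q + 1 - s) ^ 2) := by
        rw [h5, ← hc]
        linear_combination (4 * Real.sin θ ^ 2 * Real.cos θ ^ 2) * h3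
      norm_num
      linear_combination (4 * ((j:ℝ)+1) * s^j * Real.sin θ ^ 4) * h3 + ((j:ℝ)+1) * s^j * h6 +
        3 * s^(j+1) * Real.sin θ ^ 2 * hc)
    (Continuous.intervalIntegrable (by fun_prop) _ _)
  rw [intervalIntegral.integral_sub (((rgN_int q (j+1)).const_mul _).sub ((rgN_int q j).const_mul _))
    ((rgN_int q (j+2)).const_mul _), intervalIntegral.integral_sub ((rgN_int q (j+1)).const_mul _)
    ((rgN_int q j).const_mul _), intervalIntegral.integral_const_mul,
    intervalIntegral.integral_const_mul, intervalIntegral.integral_const_mul] at h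
  simp at h
  unfold rgN
  linear_combination (-(2 * q / Real.pi)) * h

lemma rg_moment (q σ : ℝ) (hq : 1 ≤ q) (hσ : 0 < σ) (k : ℕ) (hk : 1 ≤ k) :
    ∫ x, x ^ (2 * k) ∂(rectGauss q σ) =
      σ ^ (2 * k) * ∑ π ∈ ncPairPartitions (2 * k), q ^ (-(evenCnt π : ℤ)) := by
  have hq0 : q ≠ 0 := by linarith
  rw [rg_integral, rg_full q σ hq hσ, sum_ncPair]
  obtain ⟨k, rfl⟩ : ∃ m, k = m + 1 := ⟨k - 1, by omega⟩
  have e : 2 * q / Real.pi * ∫ θ in (0:ℝ)..Real.pi,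
      ((q + 1 - 2 * Real.sqrt q * Real.cos θ) ^ (k + 1) * Real.sin θ ^ 2 /
        (q + 1 - 2 * Real.sqrt q * Real.cos θ)) = rgN q k := by
    unfold rgN
    congr 1
    rw [intervalIntegral.integral_of_le Real.pi_pos.le, integral_Ioc_eq_integral_Ioo,
      intervalIntegral.integral_of_le Real.pi_pos.le, integral_Ioc_eq_integral_Ioo]
    refine setIntegral_congr_fun measurableSet_Ioo fun θ hθ => ?_
    have hs := rg_s_pos q θ hq hθ
    generalize q + 1 - 2 * Real.sqrt q * Real.cos θ = s at *
    field_simp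
    ring
  rw [e, ncF_lin q hq0 (fun m => if Even m then 1 else q⁻¹) (fun n => by simp [Nat.even_add])
    (by simp) (by simp) (rgN q) (rgN_zero q) (rgN_one q hq) (rgN_rec q hq) k, div_pow, ← pow_mul]
  field_simp

lemma rg_prob (q σ : ℝ) (hq : 1 ≤ q) (hσ : 0 < σ) : IsProbabilityMeasure (rectGauss q σ) := by
  have h1 : ∫ x, rectGaussDensity q σ x = 1 := by
    have := rg_full q σ hq hσ 0
    rw [rg_zero q hq] at this
    simpa using this
  have hint : Integrable (rectGaussDensity q σ) := Integrable.of_integral_ne_zero (by rw [h1]; simp)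
  constructor
  unfold rectGauss
  rw [withDensity_apply _ MeasurableSet.univ, Measure.restrict_univ,
    ← ofReal_integral_eq_lintegral_ofReal hint (Filter.Eventually.of_forall (rg_nonneg q σ)), h1]
  simp

lemma rg_symm (q σ : ℝ) : Measure.map (fun x : ℝ => -x) (rectGauss q σ) = rectGauss q σ := by
  ext s hs
  rw [Measure.map_apply measurable_neg hs]
  unfold rectGauss
  rw [withDensity_apply _ hs, withDensity_apply _ (measurable_neg hs),
    ← (Measure.measurePreserving_neg (volume : Measure ℝ)).setLIntegral_comp_preimage hs
      (rg_meas q σ).ennreal_ofReal]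
  simp only [rg_even]

/-- Lemma 2.4: `λ^{(q)}_{σ²}` is a compactly supported symmetric probability measure whose
`q`-rectangular free cumulants are `κ^q_{2ℓ} = δ_{ℓ,1} σ²`; equivalently, its odd moments
vanish and `∫ x^{2k} dλ = σ^{2k} Σ_π q^{-even(π)}`, summing over noncrossing pair
partitions `π` of `[2k]`. -/
theorem rectGauss_is_rectangular_gaussian (q σ : ℝ) (hq : 1 ≤ q) (hσ : 0 < σ) :
    IsProbabilityMeasure (rectGauss q σ) ∧
    rectGauss q σ
        (Set.Icc (-((1 + (Real.sqrt q)⁻¹) * σ)) ((1 + (Real.sqrt q)⁻¹) * σ))ᶜ = 0 ∧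
    Measure.map (fun x : ℝ => -x) (rectGauss q σ) = rectGauss q σ ∧
    (∀ κ : ℕ → ℝ,
      (∀ k : ℕ, 1 ≤ k →
          ∫ x, x ^ (2 * k) ∂(rectGauss q σ) =
            ∑ π ∈ ncEvenPartitions (2 * k),
              q ^ (-(evenCnt π : ℤ)) * ∏ B ∈ π.parts, κ (B.card / 2)) →
        κ 1 = σ ^ 2 ∧ ∀ ℓ : ℕ, 2 ≤ ℓ → κ ℓ = 0) ∧
    (∀ k : ℕ, Odd k → ∫ x, x ^ k ∂(rectGauss q σ) = 0) ∧
    (∀ k : ℕ, 1 ≤ k →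
        ∫ x, x ^ (2 * k) ∂(rectGauss q σ) =
          σ ^ (2 * k) * ∑ π ∈ ncPairPartitions (2 * k), q ^ (-(evenCnt π : ℤ))) := by
  have hq0 : 0 < q := by linarith
  refine ⟨rg_prob q σ hq hσ, ?_, rg_symm q σ, ?_, ?_, rg_moment q σ hq hσ⟩
  · unfold rectGauss
    rw [withDensity_apply _ measurableSet_Icc.compl]
    rw [setLIntegral_congr_fun (g := fun _ => 0) measurableSet_Icc.compl]
    · simp
    · intro x hx
      simp only
      rw [rectGaussDensity, if_neg, ENNReal.ofReal_zero]
      have hr : 0 ≤ (Real.sqrt q)⁻¹ := by positivity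
      have hr1 : (Real.sqrt q)⁻¹ ≤ 1 := inv_le_one_of_one_le₀ (Real.one_le_sqrt.2 hq)
      have ha : 0 ≤ (1 - (Real.sqrt q)⁻¹) * σ := mul_nonneg (by linarith) hσ.le
      have hb : 0 ≤ (1 + (Real.sqrt q)⁻¹) * σ := mul_nonneg (by linarith) hσ.le
      rintro (h | h)
      · exact hx ⟨h.1, by linarith [h.2]⟩
      · exact hx ⟨by linarith [h.1], h.2⟩
  · intro κ hκ
    have := cumulant_unique q hq0 κ (fun l => if l = 1 then σ ^ 2 else 0) (fun k hk => by
      rw [← hκ k hk, rg_moment q σ hq hσ k hk]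
      exact (sum_ncEven_delta q σ k (fun l => if l = 1 then σ ^ 2 else 0) (by simp)
        (fun l hl => if_neg (by omega))).symm)
    refine ⟨by rw [this 1 le_rfl]; simp, fun l hl => ?_⟩
    rw [this l (by omega)]
    exact if_neg (by omega)
  · intro k hk
    have h1 : ∫ x, x ^ k ∂(rectGauss q σ) = ∫ x, (-x) ^ k ∂(rectGauss q σ) := by
      conv_lhs => rw [← rg_symm q σ]
      exact integral_map measurable_neg.aemeasurable (by fun_prop)
    simp only [hk.neg_pow, integral_neg] at h1
    linarith
end

section
/- Let q ∈ [1,∞), let μ, ν be compactly supported symmetric probability measures on ℝ, let (p_d(x))_{d≥1} and (r_d(x))_{d≥1} be sequences of monic real polynomials of degree d with all roots real and nonnegative, such that the symmetric empirical root distributions satisfy μ̃[p_d] → μ and μ̃[r_d] → ν in the sense of moments, and fix a sequence (n_d)_{d≥1} of nonnegative integers with lim_{d→∞}(1 + n_d/d) = q. Then for every k ≥ 1, (1/d) · (sum of the k-th powers of the complex roots of p_d ⊞^{n_d}_d r_d, counted with multiplicity) converges, as d → ∞, to Σ_{π ∈ NC^even(2k)} q^{−even(π)} Π_{B∈π} (κ^q_{|B|}[μ]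 + κ^q_{|B|}[ν]); these limits are the even moments of the q-rectangular free convolution μ ⊞_q ν, so μ̃[p_d ⊞^{n_d}_d r_d] → μ ⊞_q ν in the sense of moments. -/
open Finset MeasureTheory Filter

/-- The monic polynomial of degree `d` with roots `α_1², …, α_d²`. -/
noncomputable def polyFromSqrtRoots (d : ℕ) (α : Fin d → ℝ) : Polynomial ℝ :=
  ∏ i : Fin d, (Polynomial.X - Polynomial.C (α i ^ 2))

/-- The coefficient sequence of the `(n,d)`-rectangular convolution `p ⊞^n_d r`
(with `a_0 = b_0 = 1`). -/
noncomputable def rectConvCoeff (n d : ℕ) (a b : ℕ → ℝ) (k : ℕ) : ℝ :=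
  ∑ i ∈ Finset.range (k + 1),
    (((d - i).factorial : ℝ) * ((d - (k - i)).factorial : ℝ) /
        ((d.factorial : ℝ) * ((d - k).factorial : ℝ))) *
      (((n + d - i).factorial : ℝ) * ((n + d - (k - i)).factorial : ℝ) /
        (((n + d).factorial : ℝ) * ((n + d - k).factorial : ℝ))) *
      ((if i = 0 then 1 else a i) * (if k - i = 0 then 1 else b (k - i)))

/-- The monic polynomial `x^d + Σ_{k=1}^d a_{2k} x^{d-k}`. -/
noncomputable def monicFromCoeffs (d : ℕ) (a : ℕ → ℝ) : Polynomial ℝ :=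
  Polynomial.X ^ d + ∑ k ∈ Finset.Icc 1 d, Polynomial.C (a k) * Polynomial.X ^ (d - k)

/-- The `(n,d)`-rectangular convolution `p ⊞^n_d r` of the monic polynomials with
coefficient sequences `a`, `b`. -/
noncomputable def rectConvPoly (n d : ℕ) (a b : ℕ → ℝ) : Polynomial ℝ :=
  monicFromCoeffs d (rectConvCoeff n d a b)

/-- Sum of the `k`-th powers of the complex roots of a real polynomial,
counted with multiplicity. -/
noncomputable def rootPowerSum (p : Polynomial ℝ) (k : ℕ) : ℂ :=
  ((p.map (algebraMap ℝ ℂ)).roots.map fun z => z ^ k).sum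




/-- noncrossing set partitions of a finite set `s`, as families of blocks -/
def IsNCP {α : Type*} [LinearOrder α] (s : Finset α) (P : Finset (Finset α)) : Prop :=
  (∀ B ∈ P, B.Nonempty) ∧ (∀ B ∈ P, B ⊆ s) ∧ (∀ x ∈ s, ∃ B ∈ P, x ∈ B) ∧
  (∀ B ∈ P, ∀ B' ∈ P, ∀ x, x ∈ B → x ∈ B' → B = B') ∧
  (∀ a b c d : α, a < b → b < c → c < d → ∀ B₁ ∈ P, ∀ B₂ ∈ P,
    a ∈ B₁ → c ∈ B₁ → b ∈ B₂ → d ∈ B₂ → B₁ = B₂)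

open Classical in
noncomputable def NCP {α : Type*} [LinearOrder α] (s : Finset α) : Finset (Finset (Finset α)) :=
  s.powerset.powerset.filter (IsNCP s)

lemma mem_NCP {α : Type*} [LinearOrder α] {s : Finset α} {P : Finset (Finset α)} :
    P ∈ NCP s ↔ IsNCP s P := by
  unfold NCP
  simp only [mem_filter, mem_powerset, and_iff_right_iff_imp]
  intro h B hB
  exact mem_powerset.2 (h.2.1 B hB)

noncomputable def FF {α : Type*} [LinearOrder α] (w : Finset α → ℝ) (s : Finset α) : ℝ :=
  ∑ P ∈ NCP s, ∏ B ∈ P, w B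

open Classical in
noncomputable def UUset {α : Type*} [LinearOrder α] (C t : Finset α) :
    Finset (Finset (Finset α)) := (NCP (C ∪ t)).filter (fun P => ∃ B ∈ P, C ⊆ B)

lemma mem_UUset {α : Type*} [LinearOrder α] {C t : Finset α} {P : Finset (Finset α)} :
    P ∈ UUset C t ↔ IsNCP (C ∪ t) P ∧ ∃ B ∈ P, C ⊆ B := by
  unfold UUset
  rw [mem_filter, mem_NCP]

noncomputable def UU {α : Type*} [LinearOrder α] (w : Finset α → ℝ) (C t : Finset α) : ℝ :=
  ∑ P ∈ UUset C t, ∏ B ∈ P, w B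

lemma sum_split {α : Type*} [LinearOrder α] (w : Finset α → ℝ) (s₁ s₂ : Finset α)
    (hd : Disjoint s₁ s₂) (𝒜 ℬ 𝒰 : Finset (Finset (Finset α)))
    (hA : ∀ P ∈ 𝒜, IsNCP s₁ P) (hB : ∀ P ∈ ℬ, IsNCP s₂ P)
    (hU : ∀ P, P ∈ 𝒰 ↔ ∃ P₁ ∈ 𝒜, ∃ P₂ ∈ ℬ, P = P₁ ∪ P₂) :
    ∑ P ∈ 𝒰, ∏ B ∈ P, w B = (∑ P ∈ 𝒜, ∏ B ∈ P, w B) * (∑ P ∈ ℬ, ∏ B ∈ P, w B) := by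
  classical
  have key : ∀ P₁ ∈ 𝒜, ∀ P₂ ∈ ℬ, ∀ B ∈ P₁, B ∉ P₂ := by
    intro P₁ h1 P₂ h2 B hB1 hB2
    obtain ⟨x, hx⟩ := (hA P₁ h1).1 B hB1
    exact Finset.disjoint_left.1 hd ((hA P₁ h1).2.1 B hB1 hx) ((hB P₂ h2).2.1 B hB2 hx)
  rw [sum_mul_sum, ← sum_product']
  symm
  refine sum_bij (fun p _ => p.1 ∪ p.2) ?_ ?_ ?_ ?_
  · rintro ⟨P₁, P₂⟩ h
    rw [mem_product] at h
    exact (hU _).2 ⟨P₁, h.1, P₂, h.2, rfl⟩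
  · rintro ⟨P₁, P₂⟩ h ⟨Q₁, Q₂⟩ h' heq
    rw [mem_product] at h h'
    simp only at h h' heq
    have k1 := key P₁ h.1 Q₂ h'.2
    have k2 := key Q₁ h'.1 P₂ h.2
    have k3 := key P₁ h.1 P₂ h.2
    have k4 := key Q₁ h'.1 Q₂ h'.2
    rw [Finset.ext_iff] at heq
    simp only [mem_union] at heq
    rw [Prod.mk.injEq]
    constructor
    · ext B; have := heq B; have := k1 B; have := k2 B; have := k3 B; have := k4 B; tauto
    · ext B; have := heq B; have := k1 B; have := k2 B; have := k3 B; have := k4 B; tauto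
  · intro P hP
    obtain ⟨P₁, h1, P₂, h2, h⟩ := (hU P).1 hP
    exact ⟨(P₁, P₂), mem_product.2 ⟨h1, h2⟩, h.symm⟩
  · rintro ⟨P₁, P₂⟩ h
    rw [mem_product] at h
    simp only
    rw [prod_union]
    exact Finset.disjoint_left.2 (key P₁ h.1 P₂ h.2)

/-- gluing noncrossing partitions -/
lemma IsNCP.glue {α : Type*} [LinearOrder α] {s₁ s₂ : Finset α} (hd : Disjoint s₁ s₂)
    (hc : ∀ x ∈ s₁, ∀ y ∈ s₁, ∀ z ∈ s₂, x < z → z < y → False)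
    {P₁ P₂ : Finset (Finset α)} (h1 : IsNCP s₁ P₁) (h2 : IsNCP s₂ P₂) :
    IsNCP (s₁ ∪ s₂) (P₁ ∪ P₂) := by
  obtain ⟨a1, b1, c1, d1, e1⟩ := h1
  obtain ⟨a2, b2, c2, d2, e2⟩ := h2
  have hd' : ∀ x, x ∈ s₁ → x ∉ s₂ := fun x hx => Finset.disjoint_left.1 hd hx
  refine ⟨?_, ?_, ?_, ?_, ?_⟩
  · intro B hB; rcases mem_union.1 hB with h | h
    exacts [a1 B h, a2 B h]
  · intro B hB; rcases mem_union.1 hB with h | h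
    exacts [(b1 B h).trans subset_union_left, (b2 B h).trans subset_union_right]
  · intro x hx; rcases mem_union.1 hx with h | h
    · obtain ⟨B, hB, h'⟩ := c1 x h; exact ⟨B, mem_union_left _ hB, h'⟩
    · obtain ⟨B, hB, h'⟩ := c2 x h; exact ⟨B, mem_union_right _ hB, h'⟩
  · intro B hB B' hB' x hx hx'
    rcases mem_union.1 hB with h | h <;> rcases mem_union.1 hB' with h' | h'
    · exact d1 B h B' h' x hx hx'
    · exact absurd (b2 B' h' hx') (hd' x (b1 B h hx))
    · exact absurd (b2 B h hx) (hd' x (b1 B' h' hx'))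
    · exact d2 B h B' h' x hx hx'
  · intro a b c d hab hbc hcd B hB B' hB' ha hc' hb hd''
    rcases mem_union.1 hB with h | h <;> rcases mem_union.1 hB' with h' | h'
    · exact e1 a b c d hab hbc hcd B h B' h' ha hc' hb hd''
    · exact (hc a (b1 B h ha) c (b1 B h hc') b (b2 B' h' hb) hab hbc).elim
    · exact (hc b (b1 B' h' hb) d (b1 B' h' hd'') c (b2 B h hc') hbc hcd).elim
    · exact e2 a b c d hab hbc hcd B h B' h' ha hc' hb hd''

open Classical in
/-- restricting a noncrossing partition to a union of blocks -/
lemma IsNCP.restrict {α : Type*} [LinearOrder α] {s s₁ : Finset α} (hs : s₁ ⊆ s)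
    {P : Finset (Finset α)} (h : IsNCP s P)
    (hb : ∀ B ∈ P, ∀ x ∈ B, x ∈ s₁ → B ⊆ s₁) :
    IsNCP s₁ (P.filter (fun B => B ⊆ s₁)) := by
  obtain ⟨a1, b1, c1, d1, e1⟩ := h
  refine ⟨fun B hB => a1 B (mem_filter.1 hB).1, fun B hB => (mem_filter.1 hB).2, ?_, ?_, ?_⟩
  · intro x hx
    obtain ⟨B, hB, hxB⟩ := c1 x (hs hx)
    exact ⟨B, mem_filter.2 ⟨hB, hb B hB x hxB hx⟩, hxB⟩
  · intro B hB B' hB'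
    exact d1 B (mem_filter.1 hB).1 B' (mem_filter.1 hB').1
  · intro a b c d hab hbc hcd B hB B' hB'
    exact e1 a b c d hab hbc hcd B (mem_filter.1 hB).1 B' (mem_filter.1 hB').1

lemma UU_rec {α : Type*} [LinearOrder α] (w : Finset α → ℝ) (C t : Finset α)
    (hC : C.Nonempty) (hCt : ∀ x ∈ C, ∀ y ∈ t, x < y) :
    UU w C t = w C * FF w t +
      ∑ e ∈ t, FF w (t.filter (· < e)) * UU w (C ∪ {e}) (t.filter (e < ·)) := by
  classical
  obtain ⟨c₀, hc₀⟩ := hC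
  have hdis : Disjoint C t := Finset.disjoint_left.2 fun x h1 h2 => lt_irrefl _ (hCt x h1 x h2)
  set U0 := (UUset C t).filter (fun P => C ∈ P) with hU0
  set Ue : α → Finset (Finset (Finset α)) := fun e => (UUset C t).filter
    (fun P => ∃ B ∈ P, C ⊆ B ∧ e ∈ B ∧ ∀ x ∈ B, x ∈ t → e ≤ x) with hUe
  have hdecomp : UUset C t = U0 ∪ t.biUnion Ue := by
    ext P
    simp only [hU0, hUe, mem_union, mem_filter, mem_biUnion]
    constructor
    · intro hP
      have hP' := mem_UUset.1 hP
      obtain ⟨hN, B, hB, hCB⟩ := hP'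
      by_cases hBt : (B ∩ t).Nonempty
      · right
        refine ⟨(B ∩ t).min' hBt, (mem_inter.1 (min'_mem _ hBt)).2, hP, B, hB, hCB,
          (mem_inter.1 (min'_mem _ hBt)).1, ?_⟩
        intro x hx hxt
        exact min'_le _ _ (mem_inter.2 ⟨hx, hxt⟩)
      · left
        refine ⟨hP, ?_⟩
        have : B = C := by
          apply Subset.antisymm _ hCB
          intro x hx
          rcases mem_union.1 (hN.2.1 B hB hx) with h | h
          · exact h
          · exact (hBt ⟨x, mem_inter.2 ⟨hx, h⟩⟩).elim
        rwa [← this]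
    · rintro (h | ⟨e, _, h⟩)
      exacts [h.1, h.1]
  have huniq : ∀ P, IsNCP (C ∪ t) P → ∀ B ∈ P, ∀ B' ∈ P, C ⊆ B → C ⊆ B' → B = B' :=
    fun P hP B hB B' hB' h h' => hP.2.2.2.1 B hB B' hB' c₀ (h hc₀) (h' hc₀)
  have hdisj1 : Disjoint U0 (t.biUnion Ue) := by
    rw [Finset.disjoint_left]
    intro P h1 h2
    rw [mem_filter] at h1
    obtain ⟨e, het, h2⟩ := mem_biUnion.1 h2
    obtain ⟨_, B, hB, hCB, heB, _⟩ := mem_filter.1 h2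
    have := huniq P (mem_UUset.1 h1.1).1 B hB C h1.2 hCB (Subset.refl _)
    subst this
    exact lt_irrefl _ (hCt e heB e het)
  have hdisj2 : (t : Set α).PairwiseDisjoint Ue := by
    intro e he e' he' hne
    change Disjoint (Ue e) (Ue e')
    rw [Finset.disjoint_left]
    intro P h1 h2
    obtain ⟨h0, B, hB, hCB, heB, hmin⟩ := mem_filter.1 h1
    obtain ⟨_, B', hB', hCB', heB', hmin'⟩ := mem_filter.1 h2
    have := huniq P (mem_UUset.1 h0).1 B hB B' hB' hCB hCB'
    subst this
    exact hne (le_antisymm (hmin e' heB' he') (hmin' e heB he))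
  have h0 : ∑ P ∈ U0, ∏ B ∈ P, w B = w C * FF w t := by
    have hCN : IsNCP C {C} := by
      refine ⟨?_, ?_, ?_, ?_, ?_⟩
      · intro B hB; rw [mem_singleton.1 hB]; exact ⟨c₀, hc₀⟩
      · intro B hB; rw [mem_singleton.1 hB]
      · intro x hx; exact ⟨C, mem_singleton_self _, hx⟩
      · intro B hB B' hB' _ _ _; rw [mem_singleton.1 hB, mem_singleton.1 hB']
      · intro _ _ _ _ _ _ _ B hB B' hB' _ _ _ _; rw [mem_singleton.1 hB, mem_singleton.1 hB']
    have := sum_split w C t hdis {{C}} (NCP t) U0 (by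
      intro P hP; rw [mem_singleton.1 hP]; exact hCN) (fun P hP => mem_NCP.1 hP) ?_
    · rw [this]; simp [FF]
    intro P
    simp only [hU0, mem_filter, mem_singleton, exists_eq_left, mem_UUset]
    constructor
    · rintro ⟨⟨hN, _⟩, hCP⟩
      refine ⟨P.filter (fun B => B ⊆ t), mem_NCP.2 (hN.restrict subset_union_right ?_), ?_⟩
      · intro B hB x hx hxt y hy
        rcases mem_union.1 (hN.2.1 B hB hy) with h | h
        · have := hN.2.2.2.1 B hB C hCP y hy h
          subst this
          exact (lt_irrefl _ (hCt x hx x hxt)).elim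
        · exact h
      · ext B
        simp only [mem_union, mem_singleton, mem_filter]
        constructor
        · intro hB
          by_cases hBC : B = C
          · exact Or.inl hBC
          · refine Or.inr ⟨hB, ?_⟩
            intro y hy
            rcases mem_union.1 (hN.2.1 B hB hy) with h | h
            · exact (hBC (hN.2.2.2.1 B hB C hCP y hy h)).elim
            · exact h
        · rintro (h | h)
          · rwa [h]
          · exact h.1
    · rintro ⟨P₂, hP₂, rfl⟩
      have hc : C ∈ ({C} : Finset (Finset α)) ∪ P₂ := mem_union_left _ (mem_singleton_self _)
      refine ⟨⟨hCN.glue hdis ?_ (mem_NCP.1 hP₂), C, hc, Subset.refl _⟩, hc⟩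
      intro x _ y hy z hz _ hzy
      exact lt_asymm hzy (hCt y hy z hz)
  have he : ∀ e ∈ t, ∑ P ∈ Ue e, ∏ B ∈ P, w B =
      FF w (t.filter (· < e)) * UU w (C ∪ {e}) (t.filter (e < ·)) := by
    intro e het
    have hunion : t.filter (· < e) ∪ ((C ∪ {e}) ∪ t.filter (e < ·)) = C ∪ t := by
      ext x
      simp only [mem_union, mem_filter, mem_singleton]
      rcases lt_trichotomy x e with h | h | h
      · have := not_lt_of_gt h; have := h.ne; tauto
      · subst h; simp [het]
      · have := not_lt_of_gt h; have := h.ne'; tauto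
    have hdis' : Disjoint (t.filter (· < e)) ((C ∪ {e}) ∪ t.filter (e < ·)) := by
      rw [Finset.disjoint_left]
      intro x hx
      rw [mem_filter] at hx
      simp only [mem_union, mem_filter, mem_singleton]
      rintro ((h | h) | h)
      · exact lt_irrefl _ (hCt x h x hx.1)
      · exact hx.2.ne h
      · exact lt_asymm hx.2 h.2
    refine sum_split w _ _ hdis' (NCP _) (UUset _ _) _ (fun P hP => mem_NCP.1 hP)
      (fun P hP => (mem_UUset.1 hP).1) ?_
    intro P
    simp only [hUe, mem_filter, mem_UUset, mem_NCP]
    constructor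
    · rintro ⟨⟨hN, _⟩, B, hB, hCB, heB, hmin⟩
      -- a block meeting the gap is contained in the gap
      have hgap : ∀ B' ∈ P, ∀ x ∈ B', x ∈ t.filter (· < e) → B' ⊆ t.filter (· < e) := by
        intro B' hB' x hx hxt y hy
        rw [mem_filter] at hxt
        have hne : B' ≠ B := by
          rintro rfl
          exact not_lt_of_ge (hmin x hx hxt.1) hxt.2
        have hyB : y ∉ B := fun h => hne (hN.2.2.2.1 B' hB' B hB y hy h)
        rw [mem_filter]
        rcases mem_union.1 (hN.2.1 B' hB' hy) with h | h
        · exact (hyB (hCB h)).elim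
        · refine ⟨h, ?_⟩
          rcases lt_trichotomy y e with h' | h' | h'
          · exact h'
          · subst h'; exact (hyB heB).elim
          · exact (hne (hN.2.2.2.2 c₀ x e y (hCt c₀ hc₀ x hxt.1) hxt.2 h' B hB B' hB'
              (hCB hc₀) heB hx hy).symm).elim
      have hgap' : ∀ B' ∈ P, ∀ x ∈ B', x ∈ ((C ∪ {e}) ∪ t.filter (e < ·)) →
          B' ⊆ ((C ∪ {e}) ∪ t.filter (e < ·)) := by
        intro B' hB' x hx hxt y hy
        have hyU := hN.2.1 B' hB' hy
        rw [← hunion] at hyU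
        rcases mem_union.1 hyU with h | h
        · exact (Finset.disjoint_left.1 hdis' (hgap B' hB' y hy h hx) hxt).elim
        · exact h
      refine ⟨_, hN.restrict ?_ hgap, _, ⟨hN.restrict ?_ hgap', B, ?_, ?_⟩, ?_⟩
      · rw [← hunion]; exact subset_union_left
      · rw [← hunion]; exact subset_union_right
      · rw [mem_filter]
        refine ⟨hB, hgap' B hB e heB ?_⟩
        simp
      · exact union_subset hCB (singleton_subset_iff.2 heB)
      · ext B'
        simp only [mem_union (s := P.filter _), mem_filter]
        constructor
        · intro hB'
          obtain ⟨x, hx⟩ := hN.1 B' hB'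
          have hxU := hN.2.1 B' hB' hx
          rw [← hunion] at hxU
          rcases mem_union.1 hxU with h | h
          · exact Or.inl ⟨hB', hgap B' hB' x hx h⟩
          · exact Or.inr ⟨hB', hgap' B' hB' x hx h⟩
        · rintro (h | h)
          exacts [h.1, h.1]
    · rintro ⟨P₁, h1, P₂, ⟨h2, B, hB, hCB⟩, rfl⟩
      have hN := h1.glue hdis' (by
        intro x hx y hy z hz hxz hzy
        rw [mem_filter] at hx hy
        simp only [mem_union, mem_filter, mem_singleton] at hz
        rcases hz with (h | h) | h
        · exact lt_asymm hxz (hCt z h x hx.1)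
        · subst h; exact lt_asymm hzy hy.2
        · exact lt_asymm (hzy.trans hy.2) h.2) h2
      rw [hunion] at hN
      have hCB' : C ⊆ B := subset_union_left.trans hCB
      refine ⟨⟨hN, B, mem_union_right _ hB, hCB'⟩, B, mem_union_right _ hB, hCB', ?_, ?_⟩
      · exact hCB (by simp)
      · intro x hx hxt
        have := h2.2.1 B hB hx
        simp only [mem_union, mem_filter, mem_singleton] at this
        rcases this with (h | h) | h
        · exact (lt_irrefl _ (hCt x h x hxt)).elim
        · exact h.ge
        · exact h.2.le
  unfold UU at he ⊢
  rw [hdecomp, sum_union hdisj1, sum_biUnion hdisj2, h0]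
  congr 1
  exact sum_congr rfl he

lemma FF_empty {α : Type*} [LinearOrder α] (w : Finset α → ℝ) : FF w ∅ = 1 := by
  unfold FF
  have : NCP (∅ : Finset α) = {∅} := by
    ext P
    rw [mem_NCP, mem_singleton]
    constructor
    · rintro ⟨h1, h2, _⟩
      rw [eq_empty_iff_forall_notMem]
      intro B hB
      obtain ⟨x, hx⟩ := h1 B hB
      exact absurd (h2 B hB hx) (notMem_empty x)
    · rintro rfl
      refine ⟨?_, ?_, ?_, ?_, ?_⟩ <;> simp
  rw [this]; simp

lemma FF_eq_UU {α : Type*} [LinearOrder α] (w : Finset α → ℝ) (a : α) (t : Finset α) :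
    FF w ({a} ∪ t) = UU w {a} t := by
  unfold FF UU
  congr 1
  ext P
  rw [mem_NCP, mem_UUset]
  constructor
  · intro h
    refine ⟨h, ?_⟩
    obtain ⟨B, hB, h'⟩ := h.2.2.1 a (by simp)
    exact ⟨B, hB, by simpa using h'⟩
  · exact fun h => h.1



/-- transport along a strictly monotone embedding -/
lemma IsNCP_map {α β : Type*} [LinearOrder α] [LinearOrder β] (f : α ↪o β) (s : Finset α)
    (P : Finset (Finset α)) :
    IsNCP (s.map f.toEmbedding) (P.map (mapEmbedding f.toEmbedding).toEmbedding) ↔ IsNCP s P := by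
  have hm : ∀ (B : Finset α) (x : β), x ∈ B.map f.toEmbedding ↔ ∃ y ∈ B, f y = x := by
    intro B x; simp
  have hm' : ∀ (B : Finset α) (x : α), f x ∈ B.map f.toEmbedding ↔ x ∈ B := by
    intro B x; simp
  unfold IsNCP
  simp only [forall_exists_index, and_imp, forall_apply_eq_imp_iff₂, Finset.mem_map (s := P), exists_exists_and_eq_and]
  simp only [RelEmbedding.coe_toEmbedding, mapEmbedding_apply, Finset.map_nonempty,
    Finset.map_subset_map, Finset.map_inj]
  refine and_congr Iff.rfl (and_congr Iff.rfl (and_congr ?_ (and_congr ?_ ?_)))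
  · constructor
    · intro h x hx
      obtain ⟨B, hB, h'⟩ := h (f x) ((hm' _ _).2 hx)
      exact ⟨B, hB, (hm' _ _).1 h'⟩
    · intro h x hx
      obtain ⟨y, hy, rfl⟩ := (hm _ _).1 hx
      obtain ⟨B, hB, h'⟩ := h y hy
      exact ⟨B, hB, (hm' _ _).2 h'⟩
  · constructor
    · intro h B hB B' hB' x hx hx'
      exact h B hB B' hB' (f x) ((hm' _ _).2 hx) ((hm' _ _).2 hx')
    · intro h B hB B' hB' x hx hx'
      obtain ⟨y, hy, rfl⟩ := (hm _ _).1 hx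
      exact h B hB B' hB' y hy ((hm' _ _).1 hx')
  · constructor
    · intro h a b c d hab hbc hcd B hB B' hB' h1 h2 h3 h4
      exact h (f a) (f b) (f c) (f d) (by simpa using hab) (by simpa using hbc)
        (by simpa using hcd) B hB B' hB' ((hm' _ _).2 h1) ((hm' _ _).2 h2) ((hm' _ _).2 h3)
        ((hm' _ _).2 h4)
    · intro h a b c d hab hbc hcd B hB B' hB' h1 h2 h3 h4
      obtain ⟨a, ha, rfl⟩ := (hm _ _).1 h1
      obtain ⟨c, hc, rfl⟩ := (hm _ _).1 h2
      obtain ⟨b, hb, rfl⟩ := (hm _ _).1 h3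
      obtain ⟨d, hd, rfl⟩ := (hm _ _).1 h4
      exact h a b c d (by simpa using hab) (by simpa using hbc)
        (by simpa using hcd) B hB B' hB' ha hc hb hd

lemma FF_map {α β : Type*} [LinearOrder α] [LinearOrder β] (f : α ↪o β) (s : Finset α)
    (w : Finset β → ℝ) :
    FF w (s.map f.toEmbedding) = FF (fun B => w (B.map f.toEmbedding)) s := by
  unfold FF
  symm
  refine sum_bij (fun P _ => P.map (mapEmbedding f.toEmbedding).toEmbedding) ?_ ?_ ?_ ?_
  · intro P hP
    exact mem_NCP.2 ((IsNCP_map f s P).2 (mem_NCP.1 hP))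
  · intro P _ Q _ h
    exact Finset.map_injective _ h
  · intro Q hQ
    have hQ' := mem_NCP.1 hQ
    have hsub : Q ⊆ s.powerset.map (mapEmbedding f.toEmbedding).toEmbedding := by
      intro B hB
      obtain ⟨u, hu, rfl⟩ := Finset.subset_map_iff.1 (hQ'.2.1 B hB)
      rw [Finset.mem_map]
      exact ⟨u, mem_powerset.2 hu, rfl⟩
    obtain ⟨P, _, rfl⟩ := Finset.subset_map_iff.1 hsub
    exact ⟨P, mem_NCP.2 ((IsNCP_map f s P).1 hQ'), rfl⟩
  · intro P _
    rw [Finset.prod_map]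
    rfl

/-- parity of the minimum -/
def minOdd (B : Finset ℕ) : Prop := ∃ y ∈ B, Even (y + 1) ∧ ∀ x ∈ B, y ≤ x

open Classical in
noncomputable def rho (q : ℝ) (B : Finset ℕ) : ℝ := if minOdd B then q⁻¹ else 1

noncomputable def kap (κ : ℕ → ℝ) (m : ℕ) : ℝ := if Even m then κ (m / 2) else 0

noncomputable def wt (q : ℝ) (κ : ℕ → ℝ) (B : Finset ℕ) : ℝ := rho q B * kap κ B.card

/-- the sum in the statement is a sum over noncrossing families on an interval of `ℕ` -/
lemma stmt_sum_eq (q : ℝ) (κ : ℕ → ℝ) (n : ℕ) :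
    ∑ π ∈ ncEvenPartitions n, q ^ (-(evenCnt π : ℤ)) * ∏ B ∈ π.parts, κ (B.card / 2) =
      FF (wt q κ) (Ico 0 n) := by
  classical
  have hmap : (Ico 0 n) = (univ : Finset (Fin n)).map (Fin.valOrderEmb n).toEmbedding := by
    ext x
    simp only [mem_Ico, Finset.mem_map, mem_univ, true_and]
    constructor
    · intro h; exact ⟨⟨x, h.2⟩, rfl⟩
    · rintro ⟨y, rfl⟩; exact ⟨Nat.zero_le _, y.2⟩
  rw [hmap, FF_map]
  unfold FF
  have hw : ∀ B : Finset (Fin n), wt q κ (B.map (Fin.valOrderEmb n).toEmbedding) =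
      (if ∃ y : Fin n, y ∈ B ∧ Even ((y : ℕ) + 1) ∧ ∀ x ∈ B, y ≤ x then q⁻¹ else 1) *
        kap κ B.card := by
    intro B
    unfold wt rho
    rw [card_map]
    congr 1
    have : minOdd (B.map (Fin.valOrderEmb n).toEmbedding) ↔
        ∃ y : Fin n, y ∈ B ∧ Even ((y : ℕ) + 1) ∧ ∀ x ∈ B, y ≤ x := by
      unfold minOdd
      simp only [forall_exists_index, and_imp, forall_apply_eq_imp_iff₂, Finset.mem_map, exists_exists_and_eq_and]
      rfl
    simp only [this]
  simp only [hw]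
  -- restrict right-hand sum to even partitions
  rw [← sum_filter_add_sum_filter_not (NCP (univ : Finset (Fin n)))
    (fun P => ∀ B ∈ P, Even B.card)]
  rw [sum_eq_zero (s := (NCP (univ : Finset (Fin n))).filter
    (fun P => ¬ ∀ B ∈ P, Even B.card)), add_zero]
  swap
  · intro P hP
    obtain ⟨_, h⟩ := mem_filter.1 hP
    push Not at h
    obtain ⟨B, hB, hodd⟩ := h
    refine prod_eq_zero hB ?_
    simp [kap, hodd]
  refine sum_bij (fun π _ => π.parts) ?_ ?_ ?_ ?_
  · intro π hπ
    unfold ncEvenPartitions at hπ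
    obtain ⟨_, h1, h2⟩ := mem_filter.1 hπ
    refine mem_filter.2 ⟨mem_NCP.2 ⟨?_, ?_, ?_, ?_, h1⟩, h2⟩
    · intro B hB; exact π.nonempty_of_mem_parts hB
    · intro B _; exact subset_univ _
    · intro x _; exact π.exists_mem (mem_univ x)
    · intro B hB B' hB' x hx hx'
      exact π.eq_of_mem_parts hB hB' hx hx'
  · intro π _ π' _ h
    exact Finpartition.ext h
  · intro P hP
    obtain ⟨h, he⟩ := mem_filter.1 hP
    have h := mem_NCP.1 h
    refine ⟨Finpartition.ofExistsUnique P (fun B _ => subset_univ B) ?_ ?_, ?_, rfl⟩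
    · intro x hx
      obtain ⟨B, hB, hxB⟩ := h.2.2.1 x hx
      exact ⟨B, ⟨hB, hxB⟩, fun B' hB' => h.2.2.2.1 B' hB'.1 B hB x hB'.2 hxB⟩
    · intro h0
      exact Finset.not_nonempty_empty (h.1 _ h0)
    · unfold ncEvenPartitions
      refine mem_filter.2 ⟨mem_univ _, h.2.2.2.2, he⟩
  · intro π hπ
    unfold ncEvenPartitions at hπ
    obtain ⟨_, h1, h2⟩ := mem_filter.1 hπ
    rw [prod_mul_distrib]
    congr 1
    · rw [prod_ite, prod_const_one, mul_one, prod_const, zpow_neg, zpow_natCast, inv_pow]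
      unfold evenCnt
      congr! 3
    · refine prod_congr rfl fun B hB => ?_
      simp [kap, h2 B hB]

lemma wt_shift (q : ℝ) (κ : ℕ → ℝ) (f : ℕ ↪o ℕ) (hf : ∀ x, f x = x + 2) (B : Finset ℕ) :
    wt q κ (B.map f.toEmbedding) = wt q κ B := by
  classical
  unfold wt rho
  rw [card_map]
  have : minOdd (B.map f.toEmbedding) ↔ minOdd B := by
    unfold minOdd
    simp only [forall_exists_index, and_imp, forall_apply_eq_imp_iff₂, Finset.mem_map, exists_exists_and_eq_and,
      RelEmbedding.coe_toEmbedding, hf]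
    refine exists_congr fun y => and_congr Iff.rfl (and_congr ?_ ?_)
    · have : y + 2 + 1 = y + 1 + 2 := by ring
      rw [this]; simp [parity_simps]
    · simp
  simp only [this]

noncomputable def fser (q : ℝ) (κ : ℕ → ℝ) (c : ℕ) : PowerSeries ℝ :=
  PowerSeries.mk fun n => FF (wt q κ) (Ico c (c + n))

lemma fser_add_two (q : ℝ) (κ : ℕ → ℝ) (c : ℕ) : fser q κ (c + 2) = fser q κ c := by
  unfold fser
  ext n
  simp only [PowerSeries.coeff_mk]
  let f : ℕ ↪o ℕ := OrderEmbedding.ofStrictMono (fun x => x + 2) (fun a b h => by simpa using h)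
  have hf : ∀ x, f x = x + 2 := fun x => rfl
  have : Ico (c + 2) (c + 2 + n) = (Ico c (c + n)).map f.toEmbedding := by
    ext x
    simp only [mem_Ico, Finset.mem_map, RelEmbedding.coe_toEmbedding, hf]
    constructor
    · intro h; exact ⟨x - 2, by omega, by omega⟩
    · rintro ⟨y, h, rfl⟩; omega
  rw [this, FF_map]
  simp only [wt_shift q κ f hf]

/-- no even partition of a set of odd size -/
lemma FF_odd (q : ℝ) (κ : ℕ → ℝ) (s : Finset ℕ) (hs : Odd s.card) : FF (wt q κ) s = 0 := by
  classical
  unfold FF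
  refine sum_eq_zero fun P hP => ?_
  have h := mem_NCP.1 hP
  by_contra hne
  have hev : ∀ B ∈ P, Even B.card := by
    intro B hB
    by_contra hB'
    exact hne (prod_eq_zero hB (by simp [wt, kap, hB']))
  have hcard : s.card = ∑ B ∈ P, B.card := by
    have : s = P.biUnion id := by
      ext x
      rw [mem_biUnion]
      constructor
      · intro hx; obtain ⟨B, hB, h'⟩ := h.2.2.1 x hx; exact ⟨B, hB, h'⟩
      · rintro ⟨B, hB, h'⟩; exact h.2.1 B hB h'
    rw [this, card_biUnion]
    · rfl
    · intro B hB B' hB' hne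
      refine Finset.disjoint_left.2 fun x hx hx' => hne (h.2.2.2.1 B hB B' hB' x hx hx')
  rw [hcard] at hs
  exact (Nat.not_even_iff_odd.2 hs) (Finset.even_sum _ hev)

lemma fser_odd (q : ℝ) (κ : ℕ → ℝ) (c n : ℕ) (hn : Odd n) : (fser q κ c).coeff n = 0 := by
  unfold fser
  rw [PowerSeries.coeff_mk]
  exact FF_odd _ _ _ (by simpa using hn)

/-- product of alternating series -/
noncomputable def altProd (q : ℝ) (κ : ℕ → ℝ) : ℕ → ℕ → PowerSeries ℝ
  | c, 0 => fser q κ c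
  | c, i + 1 => fser q κ c * altProd q κ (c + 1) i

lemma altProd_add_two (q : ℝ) (κ : ℕ → ℝ) (c i : ℕ) :
    altProd q κ (c + 2) i = altProd q κ c i := by
  induction i generalizing c with
  | zero => exact fser_add_two q κ c
  | succ i ih =>
    simp only [altProd]
    rw [fser_add_two, show c + 2 + 1 = (c + 1) + 2 by ring, ih]

lemma altProd_add_even (q : ℝ) (κ : ℕ → ℝ) (c i j : ℕ) (hj : Even j) :
    altProd q κ (c + j) i = altProd q κ c i := by
  obtain ⟨r, rfl⟩ := hj
  induction r with
  | zero => rfl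
  | succ r ih => rw [show c + (r + 1 + (r + 1)) = (c + (r + r)) + 2 by ring, altProd_add_two, ih]

lemma rho_union (q : ℝ) (C : Finset ℕ) (e : ℕ) (hC : C.Nonempty) (h : ∀ x ∈ C, x < e) :
    rho q (C ∪ {e}) = rho q C := by
  classical
  unfold rho
  have : minOdd (C ∪ {e}) ↔ minOdd C := by
    unfold minOdd
    obtain ⟨c, hc⟩ := hC
    constructor
    · rintro ⟨y, hy, h1, h2⟩
      have hyC : y ∈ C := by
        rcases mem_union.1 hy with h' | h'
        · exact h'
        · rw [mem_singleton] at h'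
          have := h2 c (mem_union_left _ hc)
          have := h c hc
          omega
      exact ⟨y, hyC, h1, fun x hx => h2 x (mem_union_left _ hx)⟩
    · rintro ⟨y, hy, h1, h2⟩
      refine ⟨y, mem_union_left _ hy, h1, fun x hx => ?_⟩
      rcases mem_union.1 hx with h' | h'
      · exact h2 x h'
      · rw [mem_singleton.1 h']; exact (h y hy).le
  simp only [this]

lemma UU_formula (q : ℝ) (κ : ℕ → ℝ) (n : ℕ) : ∀ (N : ℕ), n ≤ N → ∀ (c : ℕ) (C : Finset ℕ),
    C.Nonempty → (∀ x ∈ C, x < c) →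
    UU (wt q κ) C (Ico c (c + n)) = rho q C * ∑ i ∈ range (N + 1),
      kap κ (C.card + i) * (PowerSeries.X ^ i * altProd q κ c i).coeff n := by
  induction n using Nat.strong_induction_on with
  | _ n ih =>
  intro N hN c C hC hCc
  rw [UU_rec _ _ _ hC (by
    intro x hx y hy
    exact lt_of_lt_of_le (hCc x hx) (mem_Ico.1 hy).1)]
  rw [sum_range_succ']
  have h1 : ∀ e ∈ Ico c (c + n),
      FF (wt q κ) ((Ico c (c + n)).filter (· < e)) *
        UU (wt q κ) (C ∪ {e}) ((Ico c (c + n)).filter (e < ·)) =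
      rho q C * ∑ i ∈ range N, kap κ (C.card + (i + 1)) * ((fser q κ c).coeff (e - c) *
        (PowerSeries.X ^ i * altProd q κ (c + 1) i).coeff (c + n - 1 - e)) := by
    intro e he
    rw [mem_Ico] at he
    have e1 : (Ico c (c + n)).filter (· < e) = Ico c e := by
      ext x; simp only [mem_filter, mem_Ico]; omega
    have e2 : (Ico c (c + n)).filter (e < ·) = Ico (e + 1) (e + 1 + (c + n - 1 - e)) := by
      ext x; simp only [mem_filter, mem_Ico]; omega
    rw [e1, e2]
    have e3 : FF (wt q κ) (Ico c e) = (fser q κ c).coeff (e - c) := by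
      unfold fser; rw [PowerSeries.coeff_mk]; congr 2; omega
    rw [e3]
    rcases Nat.even_or_odd (e - c) with hev | hod
    · obtain ⟨N', rfl⟩ : ∃ N', N = N' + 1 := ⟨N - 1, by omega⟩
      rw [ih (c + n - 1 - e) (by omega) N' (by omega) (e + 1) (C ∪ {e})
        (hC.mono subset_union_left) (by
          intro x hx
          rcases mem_union.1 hx with h | h
          · have := hCc x h; omega
          · rw [mem_singleton] at h; omega)]
      rw [rho_union q C e hC (fun x hx => by have := hCc x hx; omega)]
      have hcard : (C ∪ {e}).card = C.card + 1 := by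
        rw [card_union_of_disjoint, card_singleton]
        rw [Finset.disjoint_singleton_right]
        intro h; have := hCc e h; omega
      rw [hcard, mul_left_comm, mul_sum]
      congr 1
      refine sum_congr rfl fun i _ => ?_
      have e4 : e + 1 = (c + 1) + (e - c) := by omega
      rw [e4, altProd_add_even _ _ _ _ _ hev]
      rw [show C.card + 1 + i = C.card + (i + 1) by ring]
      ring
    · rw [fser_odd _ _ _ _ hod]; simp
  rw [sum_congr rfl h1, ← mul_sum, sum_comm, mul_add]
  rw [add_comm]
  congr 1
  · congr 1
    refine sum_congr rfl fun i _ => ?_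
    rw [← mul_sum]
    congr 1
    have : PowerSeries.X ^ (i + 1) * altProd q κ c (i + 1) =
        PowerSeries.X * (fser q κ c * (PowerSeries.X ^ i * altProd q κ (c + 1) i)) := by
      simp only [altProd]; ring
    rw [this]
    cases n with
    | zero => simp
    | succ n =>
      rw [PowerSeries.coeff_succ_X_mul, PowerSeries.coeff_mul,
        Finset.Nat.sum_antidiagonal_eq_sum_range_succ_mk, Finset.sum_Ico_eq_sum_range]
      rw [show c + (n + 1) - c = n + 1 by omega]
      refine sum_congr rfl fun j hj => ?_
      rw [mem_range] at hj
      rw [show c + j - c = j by omega, show c + (n + 1) - 1 - (c + j) = n - j by omega]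
  · simp only [pow_zero, one_mul, altProd, add_zero, fser, PowerSeries.coeff_mk, wt]
    ring


lemma altProd_odd (q : ℝ) (κ : ℕ → ℝ) (c l : ℕ) :
    altProd q κ c (2 * l + 1) = (fser q κ c * fser q κ (c + 1)) ^ (l + 1) := by
  induction l with
  | zero => simp [altProd]
  | succ l ih =>
    rw [show 2 * (l + 1) + 1 = (2 * l + 1) + 1 + 1 by ring]
    rw [altProd, altProd, show c + 1 + 1 = c + 2 by ring, altProd_add_two, ih]
    ring

lemma sum_range_two_mul (g : ℕ → ℝ) (N : ℕ) :
    ∑ i ∈ range (2 * N), g i = ∑ l ∈ range N, (g (2 * l) + g (2 * l + 1)) := by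
  induction N with
  | zero => simp
  | succ N ih =>
    rw [show 2 * (N + 1) = 2 * N + 1 + 1 by ring, sum_range_succ, sum_range_succ, ih,
      sum_range_succ]
    ring

lemma fser_coeff (q : ℝ) (κ : ℕ → ℝ) (p N m : ℕ) (hm : 0 < m) (hmN : m ≤ 2 * N) :
    (fser q κ p).coeff m = rho q {p} * ∑ l ∈ range N, κ (l + 1) *
      ((PowerSeries.X ^ 2 * (fser q κ (p + 1) * fser q κ p)) ^ (l + 1)).coeff m := by
  obtain ⟨n, rfl⟩ : ∃ n, m = n + 1 := ⟨m - 1, by omega⟩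
  obtain ⟨N', hN'⟩ : ∃ N', 2 * N = N' + 1 := ⟨2 * N - 1, by omega⟩
  have h1 : (fser q κ p).coeff (n + 1) = UU (wt q κ) {p} (Ico (p + 1) (p + 1 + n)) := by
    rw [← FF_eq_UU]
    unfold fser
    rw [PowerSeries.coeff_mk]
    congr 1
    ext x; simp only [mem_union, mem_singleton, mem_Ico]; omega
  rw [h1, UU_formula q κ n N' (by omega) (p + 1) {p} (by simp) (by simp), ← hN',
    sum_range_two_mul]
  congr 1
  refine sum_congr rfl fun l _ => ?_
  have k1 : kap κ (({p} : Finset ℕ).card + 2 * l) = 0 := by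
    rw [card_singleton]; unfold kap; rw [if_neg]; simp [parity_simps]
  have k2 : kap κ (({p} : Finset ℕ).card + (2 * l + 1)) = κ (l + 1) := by
    rw [card_singleton, show 1 + (2 * l + 1) = 2 * (l + 1) by ring]; unfold kap
    rw [if_pos (by simp)]; congr 1; omega
  rw [k1, k2, zero_mul, zero_add, altProd_odd, show p + 1 + 1 = p + 2 by ring, fser_add_two]
  congr 1
  rw [← PowerSeries.coeff_succ_X_mul]
  congr 1
  ring

lemma rho_zero (q : ℝ) : rho q {0} = 1 := by
  unfold rho; rw [if_neg]; unfold minOdd; simp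

lemma rho_one (q : ℝ) : rho q {1} = q⁻¹ := by
  unfold rho; rw [if_pos]; unfold minOdd; simp

lemma fser_zero_coeff (q : ℝ) (κ : ℕ → ℝ) (p : ℕ) : (fser q κ p).coeff 0 = 1 := by
  unfold fser; rw [PowerSeries.coeff_mk]; simp [FF_empty]

lemma fser_one_eq (q : ℝ) (κ : ℕ → ℝ) :
    fser q κ 1 = 1 + PowerSeries.C q⁻¹ * (fser q κ 0 - 1) := by
  ext m
  rcases Nat.eq_zero_or_pos m with rfl | hm
  · simp [fser_zero_coeff, -PowerSeries.coeff_zero_eq_constantCoeff]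
  · rw [fser_coeff q κ 1 m m hm (by omega), rho_one, map_add, PowerSeries.coeff_C_mul, map_sub,
      PowerSeries.coeff_one, if_neg hm.ne', fser_coeff q κ 0 m m hm (by omega), rho_zero,
      show (1 : ℕ) + 1 = 0 + 2 by rfl, fser_add_two, mul_comm (fser q κ 0)]
    ring_nf

/-- the moment series -/
noncomputable def Mser (q : ℝ) (κ : ℕ → ℝ) : PowerSeries ℝ :=
  PowerSeries.mk fun k => FF (wt q κ) (Ico 0 (2 * k))

lemma Mser_zero (q : ℝ) (κ : ℕ → ℝ) : (Mser q κ).coeff 0 = 1 := by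
  unfold Mser; rw [PowerSeries.coeff_mk]; simp [FF_empty]

lemma expand_Mser (q : ℝ) (κ : ℕ → ℝ) :
    PowerSeries.expand 2 two_ne_zero (Mser q κ) = fser q κ 0 := by
  ext m
  rcases Nat.even_or_odd' m with ⟨k, rfl | rfl⟩
  · rw [PowerSeries.coeff_expand_mul]; unfold Mser fser; simp
  · rw [PowerSeries.coeff_expand_of_not_dvd _ _ _ (by omega), fser_odd _ _ _ _ (by simp)]

lemma Mser_coeff (q : ℝ) (hq : q ≠ 0) (κ : ℕ → ℝ) (k N : ℕ) (hk : 0 < k) (hkN : k ≤ N) :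
    (Mser q κ).coeff k = ∑ l ∈ range N, (κ (l + 1) * (q⁻¹) ^ (l + 1)) *
      ((PowerSeries.X * ((Mser q κ + PowerSeries.C (q - 1)) * Mser q κ)) ^ (l + 1)).coeff k := by
  rw [← PowerSeries.coeff_expand_mul 2 two_ne_zero, expand_Mser,
    fser_coeff q κ 0 N (2 * k) (by omega) (by omega), rho_zero, one_mul]
  refine sum_congr rfl fun l _ => ?_
  rw [mul_assoc]
  congr 1
  rw [← PowerSeries.coeff_C_mul, ← PowerSeries.coeff_expand_mul 2 two_ne_zero _ k]
  congr 1
  rw [map_pow, ← mul_pow, map_pow]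
  congr 1
  simp only [map_mul, map_add, PowerSeries.expand_X, PowerSeries.expand_C, expand_Mser, zero_add]
  rw [fser_one_eq]
  have : PowerSeries.C q⁻¹ * PowerSeries.C q = (1 : PowerSeries ℝ) := by
    rw [← map_mul, inv_mul_cancel₀ hq, map_one]
  rw [map_sub, map_one]
  linear_combination (-PowerSeries.X ^ 2 * fser q κ 0) * this


/-- the Euler operator `X d/dX` -/
noncomputable def theta {R : Type*} [CommRing R] (f : PowerSeries R) : PowerSeries R :=
  PowerSeries.X * PowerSeries.derivative R f

lemma coeff_theta {R : Type*} [CommRing R] (f : PowerSeries R) (n : ℕ) :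
    (theta f).coeff n = n * f.coeff n := by
  unfold theta
  cases n with
  | zero => simp
  | succ n => rw [PowerSeries.coeff_succ_X_mul, PowerSeries.coeff_derivative]; push_cast; ring

lemma theta_mul {R : Type*} [CommRing R] (f g : PowerSeries R) :
    theta (f * g) = f * theta g + g * theta f := by
  unfold theta
  rw [Derivation.leibniz]
  simp only [smul_eq_mul]
  ring

lemma theta_add {R : Type*} [CommRing R] (f g : PowerSeries R) :
    theta (f + g) = theta f + theta g := by
  unfold theta; rw [map_add]; ring

lemma theta_one {R : Type*} [CommRing R] : theta (1 : PowerSeries R) = 0 := by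
  ext n
  rw [coeff_theta, PowerSeries.coeff_one]
  split_ifs with h <;> simp [h]

lemma theta_C_mul {R : Type*} [CommRing R] (a : R) (f : PowerSeries R) :
    theta (PowerSeries.C a * f) = PowerSeries.C a * theta f := by
  ext n
  rw [coeff_theta, PowerSeries.coeff_C_mul, PowerSeries.coeff_C_mul, coeff_theta]; ring

noncomputable def Sop (d : ℝ) (M f : PowerSeries ℝ) : PowerSeries ℝ :=
  M * f - PowerSeries.C (1 / d) * theta f

noncomputable def Lhat (d v : ℝ) (M f : PowerSeries ℝ) : PowerSeries ℝ :=
  PowerSeries.X * (Sop d M (Sop d M f) + PowerSeries.C v * Sop d M f)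

noncomputable def wfac (d n k : ℕ) : ℝ := (d.descFactorial k : ℝ) * ((n + d).descFactorial k : ℝ)

noncomputable def Wop (d n : ℕ) (f : PowerSeries ℝ) : PowerSeries ℝ :=
  PowerSeries.mk fun k => wfac d n k * f.coeff k

noncomputable def Dop (d : ℝ) (f : PowerSeries ℝ) : PowerSeries ℝ := PowerSeries.C d * f - theta f

noncomputable def Lt (d n : ℕ) (f : PowerSeries ℝ) : PowerSeries ℝ :=
  PowerSeries.X * (Dop d (Dop d f) + PowerSeries.C (n : ℝ) * Dop d f)

lemma coeff_Dop (d : ℝ) (f : PowerSeries ℝ) (k : ℕ) :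
    (Dop d f).coeff k = (d - k) * f.coeff k := by
  unfold Dop
  rw [map_sub, PowerSeries.coeff_C_mul, coeff_theta]; ring

lemma wfac_succ (d n k : ℕ) : wfac d n (k + 1) = wfac d n k * ((d - k) * (n + d - k)) := by
  unfold wfac
  rw [Nat.descFactorial_succ, Nat.descFactorial_succ]
  by_cases h : k ≤ d
  · push_cast [Nat.cast_sub h, Nat.cast_sub (show k ≤ n + d by omega)]; ring
  · rw [Nat.descFactorial_of_lt (show d < k by omega)]; simp

lemma Lt_Wop (d n : ℕ) (f : PowerSeries ℝ) : Lt d n (Wop d n f) = Wop d n (PowerSeries.X * f) := by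
  ext k
  unfold Lt Wop
  cases k with
  | zero => simp
  | succ k =>
    rw [PowerSeries.coeff_succ_X_mul, PowerSeries.coeff_mk, PowerSeries.coeff_succ_X_mul,
      map_add, PowerSeries.coeff_C_mul, coeff_Dop, coeff_Dop, PowerSeries.coeff_mk, wfac_succ]
    ring

lemma Lt_iter_Wop (d n l : ℕ) (f : PowerSeries ℝ) :
    (Lt d n)^[l] (Wop d n f) = Wop d n (PowerSeries.X ^ l * f) := by
  induction l with
  | zero => simp
  | succ l ih => rw [Function.iterate_succ_apply', ih, Lt_Wop, pow_succ']; congr 1; ring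

lemma Dop_mul (d : ℝ) (hd : d ≠ 0) (P M f : PowerSeries ℝ)
    (h : -theta P = PowerSeries.C d * (M - 1) * P) :
    Dop d (P * f) = P * (PowerSeries.C d * Sop d M f) := by
  unfold Dop Sop
  rw [theta_mul]
  have hc : PowerSeries.C d * PowerSeries.C (1 / d) = (1 : PowerSeries ℝ) := by
    rw [← map_mul, mul_one_div_cancel hd, map_one]
  linear_combination f * h + (P * theta f) * hc

lemma Sop_C_mul (d a : ℝ) (M f : PowerSeries ℝ) :
    Sop d M (PowerSeries.C a * f) = PowerSeries.C a * Sop d M f := by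
  unfold Sop; rw [theta_C_mul]; ring

lemma Lhat_C_mul (d v a : ℝ) (M f : PowerSeries ℝ) :
    Lhat d v M (PowerSeries.C a * f) = PowerSeries.C a * Lhat d v M f := by
  unfold Lhat; simp only [Sop_C_mul]; ring

lemma Lt_mul (d n : ℕ) (hd : (d : ℝ) ≠ 0) (P M f : PowerSeries ℝ)
    (h : -theta P = PowerSeries.C (d : ℝ) * (M - 1) * P) :
    Lt d n (P * f) = P * (PowerSeries.C ((d : ℝ) ^ 2) * Lhat d (n / d) M f) := by
  unfold Lt Lhat
  rw [Dop_mul d hd P M f h, Dop_mul d hd P M _ h, Sop_C_mul]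
  have hc : PowerSeries.C (n : ℝ) = PowerSeries.C (d : ℝ) * PowerSeries.C ((n : ℝ) / d) := by
    rw [← map_mul, mul_div_cancel₀ _ hd]
  rw [hc, map_pow]
  ring

lemma Lt_iter_mul (d n l : ℕ) (hd : (d : ℝ) ≠ 0) (P M : PowerSeries ℝ)
    (h : -theta P = PowerSeries.C (d : ℝ) * (M - 1) * P) :
    (Lt d n)^[l] P = P * (PowerSeries.C ((d : ℝ) ^ (2 * l)) * (Lhat d (n / d) M)^[l] 1) := by
  induction l with
  | zero => simp
  | succ l ih =>
    rw [Function.iterate_succ_apply', ih, Lt_mul d n hd P M _ h, Lhat_C_mul,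
      Function.iterate_succ_apply', show 2 * (l + 1) = 2 + 2 * l by ring, pow_add, map_mul]
    ring

/-- scaled finite cumulants -/
noncomputable def kd (d : ℕ) (A : PowerSeries ℝ) (l : ℕ) : ℝ :=
  -((d : ℝ) ^ (2 * l) / d) * (theta A * A⁻¹).coeff l

lemma kd_mul (d : ℕ) (A B : PowerSeries ℝ) (hA : A.coeff 0 = 1) (hB : B.coeff 0 = 1) (l : ℕ) :
    kd d (A * B) l = kd d A l + kd d B l := by
  unfold kd
  rw [← mul_add, ← map_add]
  congr 2
  have hA' : A * A⁻¹ = 1 := PowerSeries.mul_inv_cancel _ (by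
    rw [← PowerSeries.coeff_zero_eq_constantCoeff_apply, hA]; exact one_ne_zero)
  have hB' : B * B⁻¹ = 1 := PowerSeries.mul_inv_cancel _ (by
    rw [← PowerSeries.coeff_zero_eq_constantCoeff_apply, hB]; exact one_ne_zero)
  rw [theta_mul, PowerSeries.mul_inv_rev]
  linear_combination (theta B * B⁻¹) * hA' + (theta A * A⁻¹) * hB'

lemma Wop_add (d n : ℕ) (f g : PowerSeries ℝ) : Wop d n (f + g) = Wop d n f + Wop d n g := by
  ext k; simp [Wop, mul_add]

lemma Wop_C_mul (d n : ℕ) (a : ℝ) (f : PowerSeries ℝ) :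
    Wop d n (PowerSeries.C a * f) = PowerSeries.C a * Wop d n f := by
  ext k; simp only [Wop, PowerSeries.coeff_mk, PowerSeries.coeff_C_mul]; ring

lemma Wop_theta (d n : ℕ) (f : PowerSeries ℝ) : Wop d n (theta f) = theta (Wop d n f) := by
  ext k; simp only [Wop, PowerSeries.coeff_mk, coeff_theta]; ring

lemma Wop_sum (d n N : ℕ) (f : ℕ → PowerSeries ℝ) :
    Wop d n (∑ l ∈ range N, f l) = ∑ l ∈ range N, Wop d n (f l) := by
  ext k; simp only [Wop, PowerSeries.coeff_mk, map_sum, mul_sum]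

lemma finite_rel (d n : ℕ) (hd : (d : ℝ) ≠ 0) (A M : PowerSeries ℝ) (hA : A.coeff 0 = 1)
    (hM : -theta (Wop d n A) = PowerSeries.C (d : ℝ) * (M - 1) * Wop d n A)
    (k N : ℕ) (hk : 0 < k) (hkN : k ≤ N) :
    M.coeff k = ∑ l ∈ range N, kd d A (l + 1) * ((Lhat d (n / d) M)^[l + 1] 1).coeff k := by
  set P := Wop d n A with hP
  have hP0 : P.coeff 0 = 1 := by simp [hP, Wop, wfac, hA]
  have hPinv : P⁻¹ * P = 1 := PowerSeries.inv_mul_cancel _ (by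
    rw [← PowerSeries.coeff_zero_eq_constantCoeff_apply, hP0]; exact one_ne_zero)
  have hA' : A * A⁻¹ = 1 := PowerSeries.mul_inv_cancel _ (by
    rw [← PowerSeries.coeff_zero_eq_constantCoeff_apply, hA]; exact one_ne_zero)
  set E := theta A * A⁻¹ with hE
  have hE0 : E.coeff 0 = 0 := by
    rw [hE, PowerSeries.coeff_mul]; simp [coeff_theta, -PowerSeries.coeff_zero_eq_constantCoeff]
  have hEA : theta A = E * A := by rw [hE]; linear_combination (-theta A) * hA'
  obtain ⟨R, hR⟩ : (PowerSeries.X ^ (N + 1) : PowerSeries ℝ) ∣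
      E - ∑ l ∈ range N, PowerSeries.C (E.coeff (l + 1)) * PowerSeries.X ^ (l + 1) := by
    rw [PowerSeries.X_pow_dvd_iff]
    intro m hm
    rw [map_sub, map_sum]
    simp only [PowerSeries.coeff_C_mul, PowerSeries.coeff_X_pow]
    cases m with
    | zero => simp [hE0, -PowerSeries.coeff_zero_eq_constantCoeff]
    | succ m =>
      rw [sum_eq_single m]
      · simp
      · intro b _ hb; rw [if_neg (by omega), mul_zero]
      · intro h; rw [mem_range] at h; omega
  have hEeq : theta A = ∑ l ∈ range N,
      PowerSeries.C (E.coeff (l + 1)) * (PowerSeries.X ^ (l + 1) * A) +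
        PowerSeries.X ^ (N + 1) * (R * A) := by
    rw [hEA]
    have : E = ∑ l ∈ range N, PowerSeries.C (E.coeff (l + 1)) * PowerSeries.X ^ (l + 1) +
      PowerSeries.X ^ (N + 1) * R := by rw [← hR]; ring
    conv_lhs => rw [this]
    rw [add_mul, sum_mul]
    congr 1
    · refine sum_congr rfl fun l _ => ?_
      ring
    · ring
  have hmain : theta P = P * ∑ l ∈ range N, PowerSeries.C (E.coeff (l + 1)) *
      (PowerSeries.C ((d : ℝ) ^ (2 * (l + 1))) * (Lhat d (n / d) M)^[l + 1] 1) +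
        Wop d n (PowerSeries.X ^ (N + 1) * (R * A)) := by
    rw [hP, ← Wop_theta, hEeq, Wop_add, Wop_sum, ← hP]
    congr 1
    rw [mul_sum]
    refine sum_congr rfl fun l _ => ?_
    rw [Wop_C_mul, ← Lt_iter_Wop, ← hP, Lt_iter_mul d n (l + 1) hd P M hM]
    ring
  have hres : (PowerSeries.X ^ (N + 1) : PowerSeries ℝ) ∣
      PowerSeries.C (d : ℝ) * (M - 1) + ∑ l ∈ range N, PowerSeries.C (E.coeff (l + 1)) *
      (PowerSeries.C ((d : ℝ) ^ (2 * (l + 1))) * (Lhat d (n / d) M)^[l + 1] 1) := by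
    have h1 : (PowerSeries.X ^ (N + 1) : PowerSeries ℝ) ∣
        Wop d n (PowerSeries.X ^ (N + 1) * (R * A)) := by
      rw [PowerSeries.X_pow_dvd_iff]
      intro m hm
      rw [Wop, PowerSeries.coeff_mk, PowerSeries.coeff_X_pow_mul', if_neg (by omega), mul_zero]
    have h2 := h1.mul_left (-P⁻¹)
    convert h2 using 1
    set Q := ∑ l ∈ range N, PowerSeries.C (E.coeff (l + 1)) *
      (PowerSeries.C ((d : ℝ) ^ (2 * (l + 1))) * (Lhat d (n / d) M)^[l + 1] 1) with hQ
    linear_combination (-(PowerSeries.C (d : ℝ) * (M - 1)) - Q) * hPinv - P⁻¹ * hM - P⁻¹ * hmain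
  have hk' := PowerSeries.X_pow_dvd_iff.1 hres k (by omega)
  rw [map_add, PowerSeries.coeff_C_mul, map_sub, PowerSeries.coeff_one, if_neg hk.ne', sub_zero,
    map_sum] at hk'
  have : M.coeff k = -(1 / (d : ℝ)) * ∑ l ∈ range N, PowerSeries.coeff k
      (PowerSeries.C (E.coeff (l + 1)) *
      (PowerSeries.C ((d : ℝ) ^ (2 * (l + 1))) * (Lhat d (n / d) M)^[l + 1] 1)) := by
    field_simp
    linear_combination hk'
  rw [this, mul_sum]
  refine sum_congr rfl fun l _ => ?_
  rw [PowerSeries.coeff_C_mul, PowerSeries.coeff_C_mul]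
  unfold kd
  rw [← hE]
  ring


/-- coefficientwise convergence up to order `N` -/
def CT (N : ℕ) (f : ℕ → PowerSeries ℝ) (g : PowerSeries ℝ) : Prop :=
  ∀ j ≤ N, Tendsto (fun d => (f d).coeff j) atTop (nhds (g.coeff j))

lemma CT.mono {N N' : ℕ} (h : N ≤ N') {f : ℕ → PowerSeries ℝ} {g : PowerSeries ℝ}
    (hf : CT N' f g) : CT N f g := fun j hj => hf j (hj.trans h)

lemma CT.mul {N : ℕ} {f f' : ℕ → PowerSeries ℝ} {g g' : PowerSeries ℝ}
    (hf : CT N f g) (hf' : CT N f' g') : CT N (fun d => f d * f' d) (g * g') := by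
  intro j hj
  simp only [PowerSeries.coeff_mul]
  refine tendsto_finsetSum _ fun p hp => ?_
  have := mem_antidiagonal.1 hp
  exact (hf p.1 (by omega)).mul (hf' p.2 (by omega))

lemma CT.add {N : ℕ} {f f' : ℕ → PowerSeries ℝ} {g g' : PowerSeries ℝ}
    (hf : CT N f g) (hf' : CT N f' g') : CT N (fun d => f d + f' d) (g + g') := by
  intro j hj
  simp only [map_add]
  exact (hf j hj).add (hf' j hj)

lemma CT.X_mul {N : ℕ} {f : ℕ → PowerSeries ℝ} {g : PowerSeries ℝ}
    (hf : CT N f g) : CT (N + 1) (fun d => PowerSeries.X * f d) (PowerSeries.X * g) := by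
  intro j hj
  cases j with
  | zero => simp
  | succ j =>
    simp only [PowerSeries.coeff_succ_X_mul]
    exact hf j (by omega)

lemma CT.C {N : ℕ} {a : ℕ → ℝ} {b : ℝ} (h : Tendsto a atTop (nhds b)) :
    CT N (fun d => PowerSeries.C (a d)) (PowerSeries.C b) := by
  intro j _
  simp only [PowerSeries.coeff_C]
  split_ifs
  · exact h
  · exact tendsto_const_nhds

lemma CT.Sop {N : ℕ} {M f : ℕ → PowerSeries ℝ} {M' g : PowerSeries ℝ}
    (hM : CT N M M') (hf : CT N f g) : CT N (fun d => Sop d (M d) (f d)) (M' * g) := by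
  intro j hj
  unfold _root_.Sop
  simp only [map_sub, PowerSeries.coeff_C_mul, coeff_theta]
  have h1 := hM.mul hf j hj
  have h2 : Tendsto (fun d : ℕ => 1 / (d : ℝ) * (j * (f d).coeff j)) atTop
      (nhds (0 * (j * g.coeff j))) :=
    tendsto_one_div_atTop_nhds_zero_nat.mul ((hf j hj).const_mul _)
  have := h1.sub h2
  simpa using this

lemma CT.Lhat {N : ℕ} {M f : ℕ → PowerSeries ℝ} {M' g : PowerSeries ℝ} {v : ℕ → ℝ} {q : ℝ}
    (hv : Tendsto v atTop (nhds (q - 1)))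
    (hM : CT N M M') (hf : CT N f g) :
    CT (N + 1) (fun d => Lhat d (v d) (M d) (f d))
      (PowerSeries.X * ((M' + PowerSeries.C (q - 1)) * M') * g) := by
  have h1 := hM.Sop hf
  have h2 := hM.Sop h1
  have h3 := (h2.add ((CT.C (N := N) hv).mul h1)).X_mul
  have e : PowerSeries.X * ((M' + PowerSeries.C (q - 1)) * M') * g =
    PowerSeries.X * (M' * (M' * g) + PowerSeries.C (q - 1) * (M' * g)) := by ring
  rw [e]
  exact h3

lemma CT.Lhat_iter {N : ℕ} {M : ℕ → PowerSeries ℝ} {M' : PowerSeries ℝ} {v : ℕ → ℝ} {q : ℝ}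
    (hv : Tendsto v atTop (nhds (q - 1))) (hM : CT N M M') (l : ℕ) :
    CT (N + 1) (fun d => (_root_.Lhat d (v d) (M d))^[l] 1)
      ((PowerSeries.X * ((M' + PowerSeries.C (q - 1)) * M')) ^ l) := by
  induction l with
  | zero => intro j _; simp
  | succ l ih =>
    simp only [Function.iterate_succ_apply']
    rw [pow_succ']
    exact CT.Lhat hv hM (ih.mono (Nat.le_succ N))

lemma lead_coeff (q : ℝ) (M' : PowerSeries ℝ) (h0 : M'.coeff 0 = 1) (l : ℕ) :
    ((PowerSeries.X * ((M' + PowerSeries.C (q - 1)) * M')) ^ l).coeff l = q ^ l := by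
  rw [mul_pow, PowerSeries.coeff_X_pow_mul', if_pos le_rfl, Nat.sub_self,
    PowerSeries.coeff_zero_eq_constantCoeff_apply, map_pow, map_mul, map_add]
  rw [← PowerSeries.coeff_zero_eq_constantCoeff_apply, h0]
  simp

/-- moments to cumulants -/
lemma mom_to_cum (q : ℝ) (hq : q ≠ 0) (κ : ℕ → ℝ) (M : ℕ → PowerSeries ℝ) (v : ℕ → ℝ)
    (K : ℕ → ℕ → ℝ) (hv : Tendsto v atTop (nhds (q - 1)))
    (hrel : ∀ᶠ d : ℕ in atTop, ∀ k N : ℕ, 0 < k → k ≤ N → (M d).coeff k =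
      ∑ l ∈ range N, K d (l + 1) * ((Lhat d (v d) (M d))^[l + 1] 1).coeff k)
    (hM : ∀ N, CT N M (Mser q κ)) (l : ℕ) :
    Tendsto (fun d => K d (l + 1)) atTop (nhds (κ (l + 1) * q⁻¹ ^ (l + 1))) := by
  induction l using Nat.strong_induction_on with
  | _ l ih =>
  have hc : ∀ i, Tendsto (fun d : ℕ => ((Lhat d (v d) (M d))^[i + 1] 1).coeff (l + 1)) atTop
      (nhds (((PowerSeries.X * ((Mser q κ + PowerSeries.C (q - 1)) * Mser q κ)) ^ (i + 1)).coeff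
        (l + 1))) := fun i => CT.Lhat_iter hv (hM l) (i + 1) (l + 1) le_rfl
  have hlead := hc l
  rw [lead_coeff q _ (Mser_zero q κ)] at hlead
  have hql : q ^ (l + 1) ≠ 0 := pow_ne_zero _ hq
  have hsum : Tendsto (fun d : ℕ => ∑ i ∈ range l, K d (i + 1) *
      ((Lhat d (v d) (M d))^[i + 1] 1).coeff (l + 1)) atTop
      (nhds (∑ i ∈ range l, (κ (i + 1) * q⁻¹ ^ (i + 1)) *
        ((PowerSeries.X * ((Mser q κ + PowerSeries.C (q - 1)) * Mser q κ)) ^ (i + 1)).coeff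
        (l + 1))) := by
    refine tendsto_finsetSum _ fun i hi => ?_
    exact (ih i (mem_range.1 hi)).mul (hc i)
  have hfin := ((hM (l + 1) (l + 1) le_rfl).sub hsum).div hlead hql
  have hval : ((Mser q κ).coeff (l + 1) - ∑ i ∈ range l, (κ (i + 1) * q⁻¹ ^ (i + 1)) *
        ((PowerSeries.X * ((Mser q κ + PowerSeries.C (q - 1)) * Mser q κ)) ^ (i + 1)).coeff
        (l + 1)) / q ^ (l + 1) = κ (l + 1) * q⁻¹ ^ (l + 1) := by
    rw [Mser_coeff q hq κ (l + 1) (l + 1) (Nat.succ_pos _) le_rfl, sum_range_succ,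
      lead_coeff q _ (Mser_zero q κ), add_sub_cancel_left, mul_div_assoc, div_self hql, mul_one]
  rw [hval] at hfin
  refine hfin.congr' ?_
  filter_upwards [hrel, hlead.eventually_ne hql] with d hd hne
  simp only [Pi.div_apply, Pi.sub_apply]
  rw [hd (l + 1) (l + 1) (Nat.succ_pos _) le_rfl, sum_range_succ, add_sub_cancel_left,
    mul_div_assoc, div_self hne, mul_one]

/-- cumulants to moments -/
lemma cum_to_mom (q : ℝ) (hq : q ≠ 0) (κ : ℕ → ℝ) (M : ℕ → PowerSeries ℝ) (v : ℕ → ℝ)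
    (K : ℕ → ℕ → ℝ) (hv : Tendsto v atTop (nhds (q - 1)))
    (hrel : ∀ᶠ d : ℕ in atTop, ∀ k N : ℕ, 0 < k → k ≤ N → (M d).coeff k =
      ∑ l ∈ range N, K d (l + 1) * ((Lhat d (v d) (M d))^[l + 1] 1).coeff k)
    (hM0 : ∀ d, (M d).coeff 0 = 1)
    (hK : ∀ l, Tendsto (fun d => K d (l + 1)) atTop (nhds (κ (l + 1) * q⁻¹ ^ (l + 1)))) (k : ℕ) :
    Tendsto (fun d => (M d).coeff k) atTop (nhds ((Mser q κ).coeff k)) := by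
  induction k using Nat.strong_induction_on with
  | _ k ih =>
  cases k with
  | zero => simp only [hM0, Mser_zero]; exact tendsto_const_nhds
  | succ k =>
    have hCT : CT k M (Mser q κ) := fun j hj => ih j (by omega)
    rw [Mser_coeff q hq κ (k + 1) (k + 1) (Nat.succ_pos _) le_rfl]
    have : Tendsto (fun d : ℕ => ∑ l ∈ range (k + 1),
        K d (l + 1) * ((Lhat d (v d) (M d))^[l + 1] 1).coeff (k + 1)) atTop
        (nhds (∑ l ∈ range (k + 1), (κ (l + 1) * (q⁻¹) ^ (l + 1)) *
      ((PowerSeries.X * ((Mser q κ + PowerSeries.C (q - 1)) * Mser q κ)) ^ (l + 1)).coeff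
        (k + 1))) := by
      refine tendsto_finsetSum _ fun i _ => ?_
      exact (hK i).mul (CT.Lhat_iter hv hCT (i + 1) (k + 1) le_rfl)
    refine this.congr' ?_
    filter_upwards [hrel] with d hd
    exact (hd (k + 1) (k + 1) (Nat.succ_pos _) le_rfl).symm


/-- power sum generating series -/
noncomputable def Nser {K : Type*} [Field K] (s : Multiset K) : PowerSeries K :=
  PowerSeries.mk fun k => if k = 0 then 0 else (s.map fun z => z ^ k).sum

noncomputable def revProd {K : Type*} [Field K] (s : Multiset K) : Polynomial K :=
  (s.map fun z => 1 - Polynomial.C z * Polynomial.X).prod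

lemma theta_lin {K : Type*} [Field K] (a : K) :
    -theta (1 - PowerSeries.C a * PowerSeries.X) =
      (1 - PowerSeries.C a * PowerSeries.X) * PowerSeries.mk fun k => if k = 0 then 0 else a ^ k := by
  ext k
  rw [map_neg, coeff_theta, sub_mul, one_mul, mul_assoc]
  simp only [map_sub, PowerSeries.coeff_one, PowerSeries.coeff_C_mul, PowerSeries.coeff_mk,
    PowerSeries.coeff_X]
  cases k with
  | zero => simp
  | succ k =>
    rw [PowerSeries.coeff_succ_X_mul, PowerSeries.coeff_mk]
    cases k with
    | zero => simp
    | succ k => simp [pow_succ']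

lemma theta_revProd {K : Type*} [Field K] (s : Multiset K) :
    -theta (revProd s : PowerSeries K) = (revProd s : PowerSeries K) * Nser s := by
  induction s using Multiset.induction with
  | empty =>
    have : Nser (0 : Multiset K) = 0 := by ext k; simp [Nser]
    rw [this]; simp [revProd, theta_one]
  | cons a s ih =>
    have h1 : (revProd (a ::ₘ s) : PowerSeries K) =
        (1 - PowerSeries.C a * PowerSeries.X) * (revProd s : PowerSeries K) := by
      simp [revProd]
    have h2 : Nser (a ::ₘ s) = (PowerSeries.mk fun k => if k = 0 then 0 else a ^ k) + Nser s := by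
      ext k
      simp only [Nser, PowerSeries.coeff_mk, map_add]
      split_ifs <;> simp
    rw [h1, h2, theta_mul]
    linear_combination (1 - PowerSeries.C a * PowerSeries.X) * ih +
      (revProd s : PowerSeries K) * theta_lin a

lemma reverse_prod_X_sub_C {K : Type*} [Field K] (s : Multiset K) :
    (s.map fun z => Polynomial.X - Polynomial.C z).prod.reverse = revProd s := by
  induction s using Multiset.induction with
  | empty => simpa [revProd] using Polynomial.reverse_C (1 : K)
  | cons a s ih =>
    rw [Multiset.map_cons, Multiset.prod_cons, Polynomial.reverse_mul_of_domain, ih]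
    have : (Polynomial.X - Polynomial.C a).reverse = 1 - Polynomial.C a * Polynomial.X := by
      ext k
      rw [Polynomial.coeff_reverse, Polynomial.natDegree_X_sub_C]
      rcases k with _ | _ | k
      · simp [Polynomial.revAt_le]
      · simp [Polynomial.revAt_le, Polynomial.coeff_one]
      · rw [Polynomial.revAt_eq_self_of_lt (by omega)]
        simp [Polynomial.coeff_one, Polynomial.coeff_X, Polynomial.coeff_C]
    rw [this]
    simp [revProd]

/-- Newton's identities for a real monic polynomial -/
lemma newton_real (p : Polynomial ℝ) (hp : p.Monic) (k : ℕ) (hk : 0 < k) :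
    rootPowerSum p k =
      (((-theta (p.reverse : PowerSeries ℝ)) * (p.reverse : PowerSeries ℝ)⁻¹).coeff k : ℝ) := by
  set φ := algebraMap ℝ ℂ
  set s := (p.map φ).roots with hs
  have hsplit : p.map φ = (s.map fun z => Polynomial.X - Polynomial.C z).prod :=
    (IsAlgClosed.splits (p.map φ)).eq_prod_roots_of_monic (hp.map φ)
  have hrev : (p.reverse).map φ = revProd s := by
    rw [← reverse_prod_X_sub_C, ← hsplit]
    ext k
    rw [Polynomial.coeff_map, Polynomial.coeff_reverse, Polynomial.coeff_reverse,
      Polynomial.coeff_map, Polynomial.natDegree_map]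
  set P : PowerSeries ℝ := (p.reverse : PowerSeries ℝ) with hP
  have hP0 : PowerSeries.constantCoeff P ≠ 0 := by
    rw [hP, ← PowerSeries.coeff_zero_eq_constantCoeff_apply, Polynomial.coeff_coe,
      Polynomial.coeff_zero_reverse, hp.leadingCoeff]
    exact one_ne_zero
  have hPinv : P * P⁻¹ = 1 := PowerSeries.mul_inv_cancel _ hP0
  have hmapP : PowerSeries.map φ P = (revProd s : PowerSeries ℂ) := by
    rw [← hrev]; ext k; simp [hP]
  have htheta : PowerSeries.map φ (theta P) = theta (PowerSeries.map φ P) := by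
    ext k; simp [coeff_theta]
  have hne : PowerSeries.map φ P ≠ 0 := by
    intro h
    have := congrArg (PowerSeries.map φ P⁻¹ * ·) h
    simp only [← map_mul, mul_zero] at this
    rw [mul_comm, hPinv, map_one] at this
    exact one_ne_zero this
  have hfin : PowerSeries.map φ (-theta P * P⁻¹) = Nser s := by
    apply mul_left_cancel₀ hne
    rw [← map_mul, show P * (-theta P * P⁻¹) = -theta P by linear_combination (-theta P) * hPinv,
      map_neg, htheta, hmapP, theta_revProd]
  have hk' := congrArg (PowerSeries.coeff k) hfin
  rw [PowerSeries.coeff_map] at hk'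
  unfold rootPowerSum
  simp only [Nser, PowerSeries.coeff_mk, if_neg hk.ne'] at hk'
  exact hk'.symm

lemma polyFromSqrtRoots_eq (d : ℕ) (α : Fin d → ℝ) :
    polyFromSqrtRoots d α =
      ((univ.val.map fun i => α i ^ 2).map fun z => Polynomial.X - Polynomial.C z).prod := by
  unfold polyFromSqrtRoots
  rw [Multiset.map_map]
  rfl

lemma polyFromSqrtRoots_monic (d : ℕ) (α : Fin d → ℝ) : (polyFromSqrtRoots d α).Monic :=
  Polynomial.monic_prod_of_monic _ _ fun i _ => Polynomial.monic_X_sub_C _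

lemma polyFromSqrtRoots_natDegree (d : ℕ) (α : Fin d → ℝ) :
    (polyFromSqrtRoots d α).natDegree = d := by
  unfold polyFromSqrtRoots
  rw [Polynomial.natDegree_prod_of_monic _ _ fun i _ => Polynomial.monic_X_sub_C _]
  simp only [Polynomial.natDegree_X_sub_C]
  simp

/-- moment series of a polynomial with nonnegative roots -/
noncomputable def Mroot (d : ℕ) (α : Fin d → ℝ) : PowerSeries ℝ :=
  PowerSeries.mk fun k => if k = 0 then 1 else (1 / (d : ℝ)) * ∑ i : Fin d, (α i ^ 2) ^ k

lemma Mroot_rel (d : ℕ) (hd : (d : ℝ) ≠ 0) (α : Fin d → ℝ) :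
    -theta ((polyFromSqrtRoots d α).reverse : PowerSeries ℝ) =
      PowerSeries.C (d : ℝ) * (Mroot d α - 1) *
        ((polyFromSqrtRoots d α).reverse : PowerSeries ℝ) := by
  rw [polyFromSqrtRoots_eq, reverse_prod_X_sub_C, theta_revProd, mul_comm]
  congr 1
  ext k
  simp only [Nser, Mroot, PowerSeries.coeff_mk, PowerSeries.coeff_C_mul, map_sub,
    PowerSeries.coeff_one]
  split_ifs
  · simp
  · rw [Multiset.map_map, sub_zero, ← mul_assoc, mul_one_div_cancel hd, one_mul]
    rfl

/-- normalised coefficient series -/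
noncomputable def Aser (d n : ℕ) (p : Polynomial ℝ) : PowerSeries ℝ :=
  PowerSeries.mk fun k => p.reverse.coeff k / wfac d n k

lemma wfac_ne_zero (d n k : ℕ) (h : k ≤ d) : wfac d n k ≠ 0 := by
  unfold wfac
  refine mul_ne_zero ?_ ?_ <;> rw [Nat.cast_ne_zero, Ne, Nat.descFactorial_eq_zero_iff_lt] <;> omega

lemma reverse_coeff_le (d : ℕ) (p : Polynomial ℝ) (hp : p.natDegree = d) (k : ℕ) (h : k ≤ d) :
    p.reverse.coeff k = p.coeff (d - k) := by
  rw [Polynomial.coeff_reverse, hp, Polynomial.revAt_le h]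

lemma reverse_coeff_gt (d : ℕ) (p : Polynomial ℝ) (hp : p.natDegree = d) (k : ℕ) (h : d < k) :
    p.reverse.coeff k = 0 := by
  rw [Polynomial.coeff_reverse, hp, Polynomial.revAt_eq_self_of_lt h]
  exact Polynomial.coeff_eq_zero_of_natDegree_lt (by omega)

lemma Wop_Aser (d n : ℕ) (p : Polynomial ℝ) (hp : p.natDegree = d) :
    Wop d n (Aser d n p) = (p.reverse : PowerSeries ℝ) := by
  ext k
  rw [Wop, Aser, PowerSeries.coeff_mk, PowerSeries.coeff_mk, Polynomial.coeff_coe]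
  rcases le_or_gt k d with h | h
  · rw [mul_div_cancel₀ _ (wfac_ne_zero d n k h)]
  · rw [reverse_coeff_gt d p hp k h]; simp

lemma Aser_zero (d n : ℕ) (p : Polynomial ℝ) (hp : p.Monic) : (Aser d n p).coeff 0 = 1 := by
  rw [Aser, PowerSeries.coeff_mk, Polynomial.coeff_zero_reverse, hp.leadingCoeff]
  simp [wfac]

lemma monicFromCoeffs_facts (d : ℕ) (a : ℕ → ℝ) :
    (monicFromCoeffs d a).Monic ∧ (monicFromCoeffs d a).natDegree = d ∧
    ∀ k, 0 < k → k ≤ d → (monicFromCoeffs d a).coeff (d - k) = a k := by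
  have hdeg : (∑ k ∈ Finset.Icc 1 d,
      Polynomial.C (a k) * Polynomial.X ^ (d - k)).degree < (d : WithBot ℕ) := by
    refine (Polynomial.degree_sum_le _ _).trans_lt ?_
    refine (Finset.sup_lt_iff (WithBot.bot_lt_coe d)).2 ?_
    intro k hk
    rw [mem_Icc] at hk
    refine (Polynomial.degree_C_mul_X_pow_le _ _).trans_lt ?_
    exact WithBot.coe_lt_coe.2 (show d - k < d by omega)
  refine ⟨Polynomial.monic_X_pow_add hdeg, ?_, ?_⟩
  · unfold monicFromCoeffs
    rw [Polynomial.natDegree_add_eq_left_of_degree_lt, Polynomial.natDegree_X_pow]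
    rwa [Polynomial.degree_X_pow]
  · intro k hk hkd
    unfold monicFromCoeffs
    rw [Polynomial.coeff_add, Polynomial.coeff_X_pow, if_neg (by omega), zero_add,
      Polynomial.finsetSum_coeff, sum_eq_single k]
    · simp
    · intro b hb hne
      rw [mem_Icc] at hb
      rw [Polynomial.coeff_C_mul_X_pow, if_neg (by omega)]
    · intro h; rw [mem_Icc] at h; omega

lemma descFactorial_real (n k : ℕ) (h : k ≤ n) :
    (n.descFactorial k : ℝ) = (n.factorial : ℝ) / ((n - k).factorial : ℝ) := by
  rw [eq_div_iff (by positivity), ← Nat.factorial_mul_descFactorial h]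
  push_cast; ring

lemma conv_rel (d n : ℕ) (p r : Polynomial ℝ) (hp : p.Monic) (hr : r.Monic)
    (hpd : p.natDegree = d) (hrd : r.natDegree = d) :
    Wop d n (Aser d n p * Aser d n r) =
      ((rectConvPoly n d (fun i => p.coeff (d - i)) (fun i => r.coeff (d - i))).reverse :
        PowerSeries ℝ) := by
  obtain ⟨h1, h2, h3⟩ := monicFromCoeffs_facts d
    (rectConvCoeff n d (fun i => p.coeff (d - i)) (fun i => r.coeff (d - i)))
  unfold rectConvPoly
  ext k
  rw [Polynomial.coeff_coe]
  rcases le_or_gt k d with h | h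
  · rcases Nat.eq_zero_or_pos k with rfl | hk
    · rw [Polynomial.coeff_zero_reverse, h1.leadingCoeff, Wop, PowerSeries.coeff_mk,
        PowerSeries.coeff_mul]
      simp [wfac, Aser_zero, hp, hr, -PowerSeries.coeff_zero_eq_constantCoeff]
    · rw [reverse_coeff_le d _ h2 k h, h3 k hk h, Wop, PowerSeries.coeff_mk,
        PowerSeries.coeff_mul, Finset.Nat.sum_antidiagonal_eq_sum_range_succ_mk, mul_sum]
      unfold rectConvCoeff
      refine sum_congr rfl fun i hi => ?_
      rw [mem_range] at hi
      simp only [Aser, PowerSeries.coeff_mk]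
      have e1 : (if i = 0 then 1 else p.coeff (d - i)) = p.reverse.coeff i := by
        rw [reverse_coeff_le d p hpd i (by omega)]
        split_ifs with h0
        · subst h0; rw [Nat.sub_zero, ← hpd]; exact hp.coeff_natDegree.symm
        · rfl
      have e2 : (if k - i = 0 then 1 else r.coeff (d - (k - i))) = r.reverse.coeff (k - i) := by
        rw [reverse_coeff_le d r hrd (k - i) (by omega)]
        split_ifs with h0
        · rw [h0, Nat.sub_zero, ← hrd]; exact hr.coeff_natDegree.symm
        · rfl
      rw [e1, e2]
      unfold wfac
      rw [descFactorial_real d k h, descFactorial_real d i (by omega),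
        descFactorial_real d (k - i) (by omega), descFactorial_real (n + d) k (by omega),
        descFactorial_real (n + d) i (by omega), descFactorial_real (n + d) (k - i) (by omega)]
      have := Nat.factorial_ne_zero
      field_simp
  · rw [reverse_coeff_gt d _ h2 k h, Wop, PowerSeries.coeff_mk]
    unfold wfac
    rw [Nat.descFactorial_of_lt h]; simp

/-- real moment series of a monic polynomial -/
noncomputable def Mpoly (d : ℕ) (p : Polynomial ℝ) : PowerSeries ℝ :=
  1 + PowerSeries.C (1 / (d : ℝ)) *
    (-theta (p.reverse : PowerSeries ℝ) * (p.reverse : PowerSeries ℝ)⁻¹)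

lemma Mpoly_rel (d : ℕ) (hd : (d : ℝ) ≠ 0) (p : Polynomial ℝ) (hp : p.Monic) :
    -theta (p.reverse : PowerSeries ℝ) =
      PowerSeries.C (d : ℝ) * (Mpoly d p - 1) * (p.reverse : PowerSeries ℝ) := by
  have hPinv : (p.reverse : PowerSeries ℝ) * (p.reverse : PowerSeries ℝ)⁻¹ = 1 :=
    PowerSeries.mul_inv_cancel _ (by
      rw [← PowerSeries.coeff_zero_eq_constantCoeff_apply, Polynomial.coeff_coe,
        Polynomial.coeff_zero_reverse, hp.leadingCoeff]
      exact one_ne_zero)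
  have hc : PowerSeries.C (d : ℝ) * PowerSeries.C (1 / (d : ℝ)) = (1 : PowerSeries ℝ) := by
    rw [← map_mul, mul_one_div_cancel hd, map_one]
  unfold Mpoly
  linear_combination (theta (p.reverse : PowerSeries ℝ) * (p.reverse : PowerSeries ℝ) *
    (p.reverse : PowerSeries ℝ)⁻¹) * hc + theta (p.reverse : PowerSeries ℝ) * hPinv

lemma Mpoly_zero (d : ℕ) (p : Polynomial ℝ) : (Mpoly d p).coeff 0 = 1 := by
  unfold Mpoly
  rw [map_add, PowerSeries.coeff_C_mul, PowerSeries.coeff_mul]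
  simp [coeff_theta, -PowerSeries.coeff_zero_eq_constantCoeff]

/-- assumptions on moments give coefficientwise convergence -/
lemma moments_CT (q : ℝ) (μ : Measure ℝ) (κμ : ℕ → ℝ)
    (hκμ : ∀ k : ℕ, 1 ≤ k →
      ∫ x, x ^ (2 * k) ∂μ =
        ∑ π ∈ ncEvenPartitions (2 * k),
          q ^ (-(evenCnt π : ℤ)) * ∏ B ∈ π.parts, κμ (B.card / 2))
    (α : (d : ℕ) → Fin d → ℝ)
    (hμmom : ∀ j : ℕ, 1 ≤ j →
      Tendsto (fun d : ℕ => (1 / (2 * (d : ℝ))) * ∑ i : Fin d, (α d i ^ j + (-α d i) ^ j))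
        atTop (nhds (∫ x, x ^ j ∂μ))) (N : ℕ) :
    CT N (fun d => Mroot d (α d)) (Mser q κμ) := by
  intro j _
  rcases Nat.eq_zero_or_pos j with rfl | hj
  · simp only [Mser_zero, Mroot, PowerSeries.coeff_mk, if_true]
    exact tendsto_const_nhds
  · have h := hμmom (2 * j) (by omega)
    rw [hκμ j hj, stmt_sum_eq] at h
    rw [Mser, PowerSeries.coeff_mk]
    refine h.congr fun d => ?_
    simp only [Mroot, PowerSeries.coeff_mk, if_neg hj.ne']
    have : ∀ i, α d i ^ (2 * j) + (-α d i) ^ (2 * j) = 2 * (α d i ^ 2) ^ j := by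
      intro i; rw [pow_mul, pow_mul, neg_sq]; ring
    simp only [this]
    rw [← mul_sum, ← mul_assoc]
    congr 1
    rcases eq_or_ne (d : ℝ) 0 with h0 | h0
    · rw [h0]; simp
    · field_simp


/-- Corollary 5.2: if `μ̃[p_d] → μ` and `μ̃[r_d] → ν` in moments, then
`μ̃[p_d ⊞^{n_d}_d r_d] → μ ⊞_q ν` in moments, in the regime `d → ∞`, `1 + n_d/d → q`:
the normalized root power sums of `p_d ⊞^{n_d}_d r_d` converge to the even moments of
`μ ⊞_q ν`, expressed through the sums `κ^q[μ] + κ^q[ν]` of the `q`-rectangular free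
cumulants of `μ` and `ν`. -/
theorem rectangular_convolution_limit
    (q : ℝ) (hq : 1 ≤ q)
    (μ ν : Measure ℝ) (hμprob : IsProbabilityMeasure μ) (hνprob : IsProbabilityMeasure ν)
    (hμsymm : Measure.map (fun x : ℝ => -x) μ = μ)
    (hνsymm : Measure.map (fun x : ℝ => -x) ν = ν)
    (hμcpt : ∃ K : Set ℝ, IsCompact K ∧ μ Kᶜ = 0)
    (hνcpt : ∃ K : Set ℝ, IsCompact K ∧ ν Kᶜ = 0)
    (κμ κν : ℕ → ℝ)
    (hκμ : ∀ k : ℕ, 1 ≤ k →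
      ∫ x, x ^ (2 * k) ∂μ =
        ∑ π ∈ ncEvenPartitions (2 * k),
          q ^ (-(evenCnt π : ℤ)) * ∏ B ∈ π.parts, κμ (B.card / 2))
    (hκν : ∀ k : ℕ, 1 ≤ k →
      ∫ x, x ^ (2 * k) ∂ν =
        ∑ π ∈ ncEvenPartitions (2 * k),
          q ^ (-(evenCnt π : ℤ)) * ∏ B ∈ π.parts, κν (B.card / 2))
    (α β : (d : ℕ) → Fin d → ℝ) (hα : ∀ d i, 0 ≤ α d i) (hβ : ∀ d i, 0 ≤ β d i)
    (hμmom : ∀ j : ℕ, 1 ≤ j →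
      Tendsto (fun d : ℕ => (1 / (2 * (d : ℝ))) * ∑ i : Fin d, (α d i ^ j + (-α d i) ^ j))
        atTop (nhds (∫ x, x ^ j ∂μ)))
    (hνmom : ∀ j : ℕ, 1 ≤ j →
      Tendsto (fun d : ℕ => (1 / (2 * (d : ℝ))) * ∑ i : Fin d, (β d i ^ j + (-β d i) ^ j))
        atTop (nhds (∫ x, x ^ j ∂ν)))
    (nseq : ℕ → ℕ)
    (hn : Tendsto (fun d : ℕ => 1 + (nseq d : ℝ) / (d : ℝ)) atTop (nhds q)) :
    ∀ k : ℕ, 1 ≤ k →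
      Tendsto
        (fun d : ℕ => (1 / (d : ℂ)) *
          rootPowerSum
            (rectConvPoly (nseq d) d
              (fun i => (polyFromSqrtRoots d (α d)).coeff (d - i))
              (fun i => (polyFromSqrtRoots d (β d)).coeff (d - i))) k)
        atTop
        (nhds ((↑(∑ π ∈ ncEvenPartitions (2 * k),
          q ^ (-(evenCnt π : ℤ)) *
            ∏ B ∈ π.parts, (κμ (B.card / 2) + κν (B.card / 2))) : ℂ))) := by
  have hq0 : q ≠ 0 := by linarith
  have hv : Tendsto (fun d : ℕ => (nseq d : ℝ) / (d : ℝ)) atTop (nhds (q - 1)) := by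
    have := hn.sub_const 1
    simpa using this
  have hd0 : ∀ᶠ d : ℕ in atTop, (d : ℝ) ≠ 0 := by
    filter_upwards [eventually_gt_atTop 0] with d hd
    exact_mod_cast hd.ne'
  have key : ∀ (κ : ℕ → ℝ) (γ : (d : ℕ) → Fin d → ℝ),
      (∀ N, CT N (fun d => Mroot d (γ d)) (Mser q κ)) → ∀ l, Tendsto (fun d : ℕ =>
        kd d (Aser d (nseq d) (polyFromSqrtRoots d (γ d))) (l + 1)) atTop
        (nhds (κ (l + 1) * q⁻¹ ^ (l + 1))) := by
    intro κ γ hCT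
    refine mom_to_cum q hq0 κ (fun d => Mroot d (γ d)) _
      (fun d l => kd d (Aser d (nseq d) (polyFromSqrtRoots d (γ d))) l) hv ?_ hCT
    filter_upwards [hd0] with d hd k N hk hkN
    refine finite_rel d (nseq d) hd _ _ (Aser_zero _ _ _ (polyFromSqrtRoots_monic _ _)) ?_ k N hk hkN
    rw [Wop_Aser _ _ _ (polyFromSqrtRoots_natDegree _ _)]
    exact Mroot_rel d hd (γ d)
  have hKα := key κμ α (moments_CT q μ κμ hκμ α hμmom)
  have hKβ := key κν β (moments_CT q ν κν hκν β hνmom)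
  intro k hk
  set R : ℕ → Polynomial ℝ := fun d => rectConvPoly (nseq d) d
    (fun i => (polyFromSqrtRoots d (α d)).coeff (d - i))
    (fun i => (polyFromSqrtRoots d (β d)).coeff (d - i)) with hR
  have hRm : ∀ d, (R d).Monic := fun d => (monicFromCoeffs_facts d _).1
  have hmain := cum_to_mom q hq0 (fun l => κμ l + κν l) (fun d => Mpoly d (R d)) _
    (fun d l => kd d (Aser d (nseq d) (polyFromSqrtRoots d (α d)) *
      Aser d (nseq d) (polyFromSqrtRoots d (β d))) l) hv (by
      filter_upwards [hd0] with d hd k N hk hkN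
      refine finite_rel d (nseq d) hd _ _ ?_ ?_ k N hk hkN
      · rw [PowerSeries.coeff_mul]
        simp [Aser_zero, polyFromSqrtRoots_monic, -PowerSeries.coeff_zero_eq_constantCoeff]
      · rw [conv_rel d (nseq d) _ _ (polyFromSqrtRoots_monic _ _) (polyFromSqrtRoots_monic _ _)
          (polyFromSqrtRoots_natDegree _ _) (polyFromSqrtRoots_natDegree _ _)]
        exact Mpoly_rel d hd (R d) (hRm d)) (fun d => Mpoly_zero d (R d)) (by
      intro l
      have := (hKα l).add (hKβ l)
      rw [← add_mul] at this
      refine this.congr fun d => ?_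
      exact (kd_mul d _ _ (Aser_zero _ _ _ (polyFromSqrtRoots_monic _ _))
        (Aser_zero _ _ _ (polyFromSqrtRoots_monic _ _)) (l + 1)).symm) k
  rw [stmt_sum_eq q (fun l => κμ l + κν l) (2 * k)]
  rw [Mser, PowerSeries.coeff_mk] at hmain
  have hmainC := (Complex.continuous_ofReal.tendsto _).comp hmain
  refine hmainC.congr fun d => ?_
  change (((Mpoly d (R d)).coeff k : ℝ) : ℂ) = 1 / (d : ℂ) * rootPowerSum (R d) k
  rw [newton_real (R d) (hRm d) k hk]
  unfold Mpoly
  rw [map_add, PowerSeries.coeff_C_mul, PowerSeries.coeff_one, if_neg (by omega), zero_add]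
  push_cast
  rfl
end
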